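/- Assume that M₁ lies in add(M) and that Hom(X⟦1⟧, Y) = 0, Hom(X⟦1⟧, M) = 0 and Hom(M⟦1⟧, Y) = 0. Then the rings A and B are derived equivalent: there exists an equivalence of categories between the derived categories of the module categories of A and of B which commutes with the shift functors and sends distinguished triangles to distinguished triangles. -/

import Mathlib

open CategoryTheory CategoryTheory.Limits CategoryTheory.Pretriangulated

universe v u u₁ u₂

/-- Two rings `R` and `S` are *derived equivalent* if there is an equivalence
between the (unbounded) derived categories of left `R`-modules and of left
`S`-modules which commutes with the shift functors and sends distinguished
triangles to distinguished triangles. -/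
def RingsDerivedEquivalent (R : Type u₁) (S : Type u₂) [Ring R] [Ring S] : Prop :=
  letI : HasDerivedCategory (ModuleCat.{u₁} R) := HasDerivedCategory.standard _
  letI : HasDerivedCategory (ModuleCat.{u₂} S) := HasDerivedCategory.standard _
  ∃ F : DerivedCategory (ModuleCat.{u₁} R) ⥤ DerivedCategory (ModuleCat.{u₂} S),
    F.IsEquivalence ∧ ∃ e : F.CommShift ℤ, by exact F.IsTriangulated

universe w₁ w₂

namespace CategoryTheory

section HomotopyLocalization

variable {𝒞 : Type*} [Category* 𝒞] [Preadditive 𝒞]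
  {𝒜 : Type*} [Category* 𝒜] [Abelian 𝒜] (F : 𝒞 ⥤ 𝒜) [F.Additive]

/-- The complexes in `𝒞` whose image under `F` is acyclic, as objects of the homotopy category. -/
def mapAcyclic : ObjectProperty (HomotopyCategory 𝒞 (ComplexShape.up ℤ)) :=
  (HomotopyCategory.subcategoryAcyclic 𝒜).inverseImage
    (F.mapHomotopyCategory (ComplexShape.up ℤ))

lemma mapAcyclic_quotient_iff (K : CochainComplex 𝒞 ℤ) :
    mapAcyclic F ((HomotopyCategory.quotient _ _).obj K) ↔
      HomologicalComplex.Acyclic ((F.mapHomologicalComplex (ComplexShape.up ℤ)).obj K) :=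
  HomotopyCategory.quotient_obj_mem_subcategoryAcyclic_iff_acyclic
    ((F.mapHomologicalComplex (ComplexShape.up ℤ)).obj K)

variable [HasZeroObject 𝒞] [HasBinaryBiproducts 𝒞]

instance : (mapAcyclic F).IsTriangulated := by
  dsimp [mapAcyclic]; infer_instance

lemma trW_mapAcyclic_quotient_iff {K L : CochainComplex 𝒞 ℤ} (f : K ⟶ L) :
    (mapAcyclic F).trW ((HomotopyCategory.quotient _ _).map f) ↔
      QuasiIso ((F.mapHomologicalComplex (ComplexShape.up ℤ)).map f) := by
  rw [mapAcyclic, ObjectProperty.inverseImage_trW_iff,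
    ← HomotopyCategory.quasiIso_eq_trW_subcategoryAcyclic]
  exact HomotopyCategory.quotient_map_mem_quasiIso_iff
    ((F.mapHomologicalComplex (ComplexShape.up ℤ)).map f)

variable [HasDerivedCategory.{w₁} 𝒜]

/-- If the functor from complexes in `𝒞` to the derived category is a localization functor, then
so is the functor from the homotopy category of `𝒞`. -/
lemma isLocalization_mapHomotopyCategory_comp_Qh
    [(F.mapHomologicalComplex (ComplexShape.up ℤ) ⋙ DerivedCategory.Q).IsLocalization
      ((HomologicalComplex.quasiIso 𝒜 (ComplexShape.up ℤ)).inverseImage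
        (F.mapHomologicalComplex (ComplexShape.up ℤ)))] :
    (F.mapHomotopyCategory (ComplexShape.up ℤ) ⋙ DerivedCategory.Qh).IsLocalization
      (mapAcyclic F).trW := by
  let W := ((HomologicalComplex.quasiIso 𝒜 (ComplexShape.up ℤ)).inverseImage
        (F.mapHomologicalComplex (ComplexShape.up ℤ)))
  let e : F.mapHomologicalComplex (ComplexShape.up ℤ) ⋙ DerivedCategory.Q ≅
      HomotopyCategory.quotient 𝒞 (ComplexShape.up ℤ) ⋙
        F.mapHomotopyCategory (ComplexShape.up ℤ) ⋙ DerivedCategory.Qh :=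
    Functor.isoWhiskerLeft _ (DerivedCategory.quotientCompQhIso 𝒜).symm ≪≫
      (Functor.associator _ _ _).symm ≪≫
      Functor.isoWhiskerRight (F.mapHomotopyCategoryFactors (ComplexShape.up ℤ)).symm _ ≪≫
      Functor.associator _ _ _
  have : (HomotopyCategory.quotient 𝒞 (ComplexShape.up ℤ) ⋙
        F.mapHomotopyCategory (ComplexShape.up ℤ) ⋙ DerivedCategory.Qh).IsLocalization W :=
    Functor.IsLocalization.of_iso W e
  refine Functor.IsLocalization.of_comp (HomotopyCategory.quotient 𝒞 (ComplexShape.up ℤ)) _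
    (HomologicalComplex.homotopyEquivalences 𝒞 (ComplexShape.up ℤ)) _ W ?_ ?_
  · intro K L f hf
    have : IsIso ((HomotopyCategory.quotient _ _).map f) :=
      HomotopyCategory.quotient_inverts_homotopyEquivalences _ _ _ hf
    exact (trW_mapAcyclic_quotient_iff F f).1
      ((mapAcyclic F).trW.of_isIso ((HomotopyCategory.quotient _ _).map f))
  · ext K L f
    constructor
    · intro hf
      obtain ⟨K, rfl⟩ := HomotopyCategory.quotient_obj_surjective K
      obtain ⟨L, rfl⟩ := HomotopyCategory.quotient_obj_surjective L
      obtain ⟨f, rfl⟩ := (HomotopyCategory.quotient _ _).map_surjective f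
      exact MorphismProperty.map_mem_map W (HomotopyCategory.quotient _ _) f
        ((trW_mapAcyclic_quotient_iff F f).1 hf)
    · revert K L f
      rw [← MorphismProperty.le_def, MorphismProperty.map_le_iff]
      intro K L f hf
      exact (trW_mapAcyclic_quotient_iff F f).2 hf

end HomotopyLocalization

section

variable {𝒞 : Type*} [Category* 𝒞] [Preadditive 𝒞] [HasZeroObject 𝒞] [HasBinaryBiproducts 𝒞]
  {𝒜 : Type*} [Category* 𝒜] [Abelian 𝒜] [HasDerivedCategory.{w₁} 𝒜]
  {ℬ : Type*} [Category* ℬ] [Abelian ℬ] [HasDerivedCategory.{w₂} ℬ]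
  (F : 𝒞 ⥤ 𝒜) [F.Additive] (G : 𝒞 ⥤ ℬ) [G.Additive]

/-- If the derived categories of `𝒜` and `ℬ` are both localizations of the category of complexes
in `𝒞`, with respect to the same class of morphisms, then they are equivalent. -/
theorem exists_derivedCategory_equivalence
    [(F.mapHomologicalComplex (ComplexShape.up ℤ) ⋙ DerivedCategory.Q).IsLocalization
      ((HomologicalComplex.quasiIso 𝒜 (ComplexShape.up ℤ)).inverseImage
        (F.mapHomologicalComplex (ComplexShape.up ℤ)))]
    [(G.mapHomologicalComplex (ComplexShape.up ℤ) ⋙ DerivedCategory.Q).IsLocalization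
      ((HomologicalComplex.quasiIso ℬ (ComplexShape.up ℤ)).inverseImage
        (G.mapHomologicalComplex (ComplexShape.up ℤ)))]
    (h : ∀ K : CochainComplex 𝒞 ℤ,
      HomologicalComplex.Acyclic ((F.mapHomologicalComplex (ComplexShape.up ℤ)).obj K) ↔
      HomologicalComplex.Acyclic ((G.mapHomologicalComplex (ComplexShape.up ℤ)).obj K)) :
    ∃ E : DerivedCategory 𝒜 ⥤ DerivedCategory ℬ,
      E.IsEquivalence ∧ ∃ _ : E.CommShift ℤ, E.IsTriangulated := by
  have hP : mapAcyclic F = mapAcyclic G := by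
    ext K
    obtain ⟨K, rfl⟩ := HomotopyCategory.quotient_obj_surjective K
    rw [mapAcyclic_quotient_iff, mapAcyclic_quotient_iff, h]
  let W := (mapAcyclic F).trW
  let LF := F.mapHomotopyCategory (ComplexShape.up ℤ) ⋙ DerivedCategory.Qh
  let LG := G.mapHomotopyCategory (ComplexShape.up ℤ) ⋙ DerivedCategory.Qh
  have : LF.IsLocalization W := isLocalization_mapHomotopyCategory_comp_Qh F
  have : LG.IsLocalization W := by
    dsimp only [W]; rw [hP]; exact isLocalization_mapHomotopyCategory_comp_Qh G
  let E : DerivedCategory 𝒜 ⥤ DerivedCategory ℬ := (Localization.uniq LF LG W).functor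
  let : Localization.Lifting LF W LG E := ⟨Localization.compUniqFunctor LF LG W⟩
  let : E.CommShift ℤ := Functor.commShiftOfLocalization LF W ℤ LG E
  have : LF.mapArrow.EssSurj := Localization.essSurj_mapArrow LF W
  have : NatTrans.CommShift (Localization.Lifting.iso LF W LG E).hom ℤ := inferInstance
  exact ⟨E, inferInstance, inferInstance,
    Functor.isTriangulated_of_precomp_iso (Localization.Lifting.iso LF W LG E)⟩

end

end CategoryTheory

namespace CategoryTheory

section FunctorialResolutions

variable {C₁ C₂ : Type*} [Category* C₁] [Category* C₂] {W₁ : MorphismProperty C₁}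
  {W₂ : MorphismProperty C₂} (Φ : LocalizerMorphism W₁ W₂) [Φ.functor.Full] [Φ.functor.Faithful]
  [W₂.HasTwoOutOfThreeProperty]

lemma LocalizerMorphism.isLocalization_of_functorial_left_resolutions
    {ρ : C₂ ⥤ C₁} (p : ρ ⋙ Φ.functor ⟶ 𝟭 C₂) (hp : ∀ X, W₂ (p.app X))
    (hW₁ : W₁ = W₂.inverseImage Φ.functor) {D : Type*} [Category* D] (L : C₂ ⥤ D)
    [L.IsLocalization W₂] : (Φ.functor ⋙ L).IsLocalization W₁ := by
  have : Φ.op.functor.Full := inferInstanceAs Φ.functor.op.Full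
  have : Φ.op.functor.Faithful := inferInstanceAs Φ.functor.op.Faithful
  have : Φ.op.IsLocalizedEquivalence :=
    Φ.op.isLocalizedEquivalence_of_functorial_right_resolutions (ρ := ρ.op)
      (NatTrans.op p) (fun X ↦ hp X.unop) (congrArg MorphismProperty.op hW₁)
  exact (Functor.IsLocalization.op_iff _ _).1
    (LocalizerMorphism.IsLocalizedEquivalence.isLocalization Φ.op L.op)

end FunctorialResolutions

section ComplexResolutions

variable {𝒞 : Type*} [Category* 𝒞] [Preadditive 𝒞]
  {𝒜 : Type*} [Category* 𝒜] [Abelian 𝒜] (F : 𝒞 ⥤ 𝒜) [F.Additive] [F.Full] [F.Faithful]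

lemma essImage_mapHomologicalComplex_obj {ι : Type*} {c : ComplexShape ι}
    {K : HomologicalComplex 𝒜 c} (hK : ∀ n, F.essImage (K.X n)) :
    (F.mapHomologicalComplex c).essImage K := by
  choose X e using hK
  let e n : F.obj (X n) ≅ K.X n := (e n).some
  let L : HomologicalComplex 𝒞 c :=
    { X := X
      d i j := F.preimage ((e i).hom ≫ K.d i j ≫ (e j).inv)
      shape i j hij := F.map_injective (by simp [K.shape i j hij])
      d_comp_d' i j k _ _ := F.map_injective (by simp) }
  exact ⟨L, ⟨HomologicalComplex.Hom.isoOfComponents e (fun i j _ ↦ by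
    change (e i).hom ≫ K.d i j = F.map (F.preimage ((e i).hom ≫ K.d i j ≫ (e j).inv)) ≫ (e j).hom
    simp)⟩⟩

/-- The localizer morphism from complexes in `𝒞` to complexes in `𝒜` with quasi-isomorphisms. -/
def mapComplexLocalizerMorphism :
    LocalizerMorphism ((HomologicalComplex.quasiIso 𝒜 (ComplexShape.up ℤ)).inverseImage
        (F.mapHomologicalComplex (ComplexShape.up ℤ)))
      (HomologicalComplex.quasiIso 𝒜 (ComplexShape.up ℤ)) where
  functor := F.mapHomologicalComplex (ComplexShape.up ℤ)
  map _ _ _ hf := hf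

instance : (mapComplexLocalizerMorphism F).functor.Full :=
  inferInstanceAs (F.mapHomologicalComplex (ComplexShape.up ℤ)).Full

instance : (mapComplexLocalizerMorphism F).functor.Faithful :=
  inferInstanceAs (F.mapHomologicalComplex (ComplexShape.up ℤ)).Faithful

variable [HasDerivedCategory 𝒜]

lemma isLocalization_of_functorial_right_resolutions
    {ρ : CochainComplex 𝒜 ℤ ⥤ CochainComplex 𝒜 ℤ} (i : 𝟭 _ ⟶ ρ) (hi : ∀ K, QuasiIso (i.app K))
    (hρ : ∀ K n, F.essImage ((ρ.obj K).X n)) :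
    (F.mapHomologicalComplex (ComplexShape.up ℤ) ⋙ DerivedCategory.Q).IsLocalization
      ((HomologicalComplex.quasiIso 𝒜 (ComplexShape.up ℤ)).inverseImage
        (F.mapHomologicalComplex (ComplexShape.up ℤ))) := by
  have hρ' K := essImage_mapHomologicalComplex_obj F (hρ K)
  let e := Functor.essImage.liftFunctorCompIso ρ (F.mapHomologicalComplex _) hρ'
  have := (mapComplexLocalizerMorphism F).isLocalizedEquivalence_of_functorial_right_resolutions
    (i ≫ e.inv) (fun K ↦ by
      have := hi K
      change QuasiIso (i.app K ≫ e.inv.app K)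
      infer_instance) rfl
  exact LocalizerMorphism.IsLocalizedEquivalence.isLocalization (mapComplexLocalizerMorphism F)
    DerivedCategory.Q

lemma isLocalization_of_functorial_left_resolutions
    {ρ : CochainComplex 𝒜 ℤ ⥤ CochainComplex 𝒜 ℤ} (p : ρ ⟶ 𝟭 _) (hp : ∀ K, QuasiIso (p.app K))
    (hρ : ∀ K n, F.essImage ((ρ.obj K).X n)) :
    (F.mapHomologicalComplex (ComplexShape.up ℤ) ⋙ DerivedCategory.Q).IsLocalization
      ((HomologicalComplex.quasiIso 𝒜 (ComplexShape.up ℤ)).inverseImage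
        (F.mapHomologicalComplex (ComplexShape.up ℤ))) := by
  have hρ' K := essImage_mapHomologicalComplex_obj F (hρ K)
  let e := Functor.essImage.liftFunctorCompIso ρ (F.mapHomologicalComplex _) hρ'
  exact (mapComplexLocalizerMorphism F).isLocalization_of_functorial_left_resolutions
    (e.hom ≫ p) (fun K ↦ by
      have := hp K
      change QuasiIso (e.hom.app K ≫ p.app K)
      infer_instance) rfl DerivedCategory.Q

end ComplexResolutions

end CategoryTheory

namespace CochainComplex

open HomologicalComplex HomComplex

namespace mappingCocone

variable {C : Type*} [Category* C] [Preadditive C] {K L : CochainComplex C ℤ} (φ : K ⟶ L)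
  [HasHomotopyCofiber φ]

lemma ext_to (p q : ℤ) (hpq : p + -1 = q) {A : C} {a b : A ⟶ (mappingCocone φ).X p}
    (h₁ : a ≫ (fst φ).f p = b ≫ (fst φ).f p)
    (h₂ : a ≫ (snd φ).v p q hpq = b ≫ (snd φ).v p q hpq) : a = b := by
  rw [← Category.comp_id a, ← Category.comp_id b, ← id_X φ p q hpq]
  simp only [Preadditive.comp_add, ← Category.assoc, h₁, h₂]

lemma δ_snd : δ (-1) 0 (snd φ) = -Cochain.ofHom (fst φ ≫ φ) := by
  have : snd φ = descCochain φ 0 (Cochain.ofHom (𝟙 L)) (neg_add_cancel 1) := by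
    ext p q hpq
    rw [← cancel_epi (𝟙 _), ← id_X φ p q hpq]
    simp only [Preadditive.add_comp, Category.assoc, inl_v_descCochain_v,
      inr_v_descCochain_v _ _ _ _ q p (by lia) q hpq, inl_v_snd_v, inr_v_snd_v]
    simp
  rw [this, δ_descCochain _ _ _ _ 1 (by lia)]
  simp

lemma d_snd_v (p q r : ℤ) (hpq : p + 1 = q) (hr : r + 1 = p) :
    (mappingCocone φ).d p q ≫ (snd φ).v q p (by lia) =
      -((fst φ).f p ≫ φ.f p) - (snd φ).v p r (by lia) ≫ L.d r p := by
  have := Cochain.congr_v (δ_snd φ) p p (add_zero p)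
  rw [δ_v (-1) 0 (by lia) _ p p _ r q (by lia) (by lia)] at this
  simp only [Int.negOnePow_zero, one_smul, Cochain.neg_v, Cochain.ofHom_v, comp_f] at this
  rw [← this]
  abel

section

variable {K' L' : CochainComplex C ℤ} (φ' : K' ⟶ L') [HasHomotopyCofiber φ']
  (a : K ⟶ K') (b : L ⟶ L') (comm : φ ≫ b = a ≫ φ')

/-- The functoriality of the mapping cocone. -/
noncomputable def map : mappingCocone φ ⟶ mappingCocone φ' :=
  lift φ' (fst φ ≫ a) ((snd φ).comp (Cochain.ofHom b) (add_zero _)) (by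
    rw [δ_comp_ofHom, δ_snd, Cochain.neg_comp, ← Cochain.ofHom_comp]
    simp [comm])

@[simp]
lemma map_f_fst_f (p : ℤ) :
    (map φ φ' a b comm).f p ≫ (fst φ').f p = (fst φ).f p ≫ a.f p := by
  simp [map]

@[simp]
lemma map_f_fst_f_assoc (p : ℤ) {Z : C} (h : K'.X p ⟶ Z) :
    (map φ φ' a b comm).f p ≫ (fst φ').f p ≫ h = (fst φ).f p ≫ a.f p ≫ h := by
  rw [← Category.assoc, map_f_fst_f, Category.assoc]

@[simp]
lemma map_f_snd_v (p q : ℤ) (hpq : p + -1 = q) :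
    (map φ φ' a b comm).f p ≫ (snd φ').v p q hpq = (snd φ).v p q hpq ≫ b.f q := by
  simp [map]

@[simp]
lemma map_f_snd_v_assoc (p q : ℤ) (hpq : p + -1 = q) {Z : C} (h : L'.X q ⟶ Z) :
    (map φ φ' a b comm).f p ≫ (snd φ').v p q hpq ≫ h = (snd φ).v p q hpq ≫ b.f q ≫ h := by
  rw [← Category.assoc, map_f_snd_v, Category.assoc]

end

end mappingCocone

end CochainComplex

namespace CochainComplex.mappingCocone

open HomologicalComplex HomComplex

variable {C : Type*} [Category* C] [Abelian C]

/-- If `S` is a short complex of cochain complexes, this is the canonical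
morphism from `S.X₁` to the mapping cocone of `S.g`. -/
noncomputable def liftShortComplex (S : ShortComplex (CochainComplex C ℤ)) :
    S.X₁ ⟶ mappingCocone S.g := lift S.g S.f 0 (by simp)

lemma liftShortComplex_map {S₁ S₂ : ShortComplex (CochainComplex C ℤ)} (f : S₁ ⟶ S₂) :
    liftShortComplex S₁ ≫ map S₁.g S₂.g f.τ₂ f.τ₃ f.comm₂₃.symm =
      f.τ₁ ≫ liftShortComplex S₂ := by
  ext p
  apply ext_to _ p (p + -1) rfl
  · simp only [liftShortComplex, comp_f, Category.assoc, map_f_fst_f, lift_f_fst_f_assoc,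
      lift_f_fst_f]
    rw [← comp_f, ← comp_f, f.comm₁₂]
  · simp [liftShortComplex]

lemma quasiIso_liftShortComplex {S : ShortComplex (CochainComplex C ℤ)} (hS : S.ShortExact) :
    QuasiIso (liftShortComplex S) where
  quasiIsoAt n := by
    have := hS.mono_f
    have := hS.epi_g
    have hex (p : ℤ) {A : C} (x : A ⟶ S.X₂.X p) (hx : x ≫ S.g.f p = 0) :
        ∃ (A' : C) (π : A' ⟶ A) (_ : Epi π) (t : A' ⟶ S.X₁.X p), π ≫ x = t ≫ S.f.f p :=
      (hS.map_of_exact (eval C _ p)).exact.exact_up_to_refinements x hx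
    have hmono (p : ℤ) : Mono (S.f.f p) := inferInstance
    obtain ⟨m, rfl⟩ : ∃ m, n = m + 1 := ⟨n - 1, by lia⟩
    obtain ⟨l, rfl⟩ : ∃ l, m = l + 1 := ⟨m - 1, by lia⟩
    set k := l + 1
    rw [quasiIsoAt_iff_isIso_homologyMap]
    have h₁ : Mono (homologyMap (liftShortComplex S) (k + 1)) := by
      rw [mono_homologyMap_iff_up_to_refinements _ k (k + 1) (k + 1 + 1) (by simp) (by simp)]
      intro A x hx y hy
      have hy₁ := hy =≫ (fst S.g).f _
      have hy₂ := hy =≫ (snd S.g).v (k + 1) k (by lia)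
      simp only [liftShortComplex, Category.assoc, lift_f_fst_f, lift_f_snd_v, ← Hom.comm,
        d_snd_v S.g k (k + 1) l rfl rfl, Cochain.zero_v, comp_zero, Preadditive.comp_sub,
        Preadditive.comp_neg] at hy₁ hy₂
      obtain ⟨A₁, π₁, _, z, hz⟩ := surjective_up_to_refinements_of_epi (S.g.f l)
        (y ≫ (snd S.g).v k l (by lia))
      obtain ⟨A₂, π₂, _, t, ht⟩ := hex k (π₁ ≫ y ≫ (fst S.g).f k + z ≫ S.X₂.d l k) (by
          have : z ≫ S.X₂.d l k ≫ S.g.f k = π₁ ≫ y ≫ (snd S.g).v k l (by lia) ≫ S.X₃.d l k := by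
            rw [← Hom.comm, ← Category.assoc, ← hz]
            simp
          have h2 := π₁ ≫= hy₂
          simp only [comp_zero, Preadditive.comp_sub, Preadditive.comp_neg] at h2
          simp only [Preadditive.add_comp, Category.assoc, this]
          rw [eq_comm, ← neg_eq_zero] at h2
          rw [← h2]
          abel)
      refine ⟨A₂, π₂ ≫ π₁, inferInstance, t, ?_⟩
      rw [← cancel_mono (S.f.f (k + 1))]
      have ht' := ht =≫ S.X₂.d k (k + 1)
      simp only [Preadditive.comp_add, Preadditive.add_comp, Category.assoc, d_comp_d, comp_zero,
        add_zero, ← Hom.comm] at ht' ⊢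
      rw [hy₁, ht']
    have h₂ : Epi (homologyMap (liftShortComplex S) (k + 1)) := by
      rw [epi_homologyMap_iff_up_to_refinements _ k (k + 1) (k + 1 + 1) (by simp) (by simp)]
      intro A y hy
      have hy₁ := hy =≫ (fst S.g).f _
      have hy₂ := hy =≫ (snd S.g).v (k + 1 + 1) (k + 1) (by lia)
      simp only [Category.assoc, ← Hom.comm, zero_comp,
        d_snd_v S.g (k + 1) (k + 1 + 1) k rfl rfl, Preadditive.comp_sub,
        Preadditive.comp_neg] at hy₁ hy₂
      obtain ⟨A₁, π₁, _, z, hz⟩ := surjective_up_to_refinements_of_epi (S.g.f k)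
        (y ≫ (snd S.g).v (k + 1) k (by lia))
      obtain ⟨A₂, π₂, _, t, ht⟩ := hex (k + 1) (π₁ ≫ y ≫ (fst S.g).f (k + 1) + z ≫ S.X₂.d k (k + 1)) (by
          have : z ≫ S.X₂.d k (k + 1) ≫ S.g.f (k + 1) =
              π₁ ≫ y ≫ (snd S.g).v (k + 1) k (by lia) ≫ S.X₃.d k (k + 1) := by
            rw [← Hom.comm, ← Category.assoc, ← hz]
            simp
          have h2 := π₁ ≫= hy₂
          simp only [comp_zero, Preadditive.comp_sub, Preadditive.comp_neg] at h2
          simp only [Preadditive.add_comp, Category.assoc, this]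
          rw [← neg_eq_zero] at h2
          rw [← h2]
          abel)
      refine ⟨A₂, π₂ ≫ π₁, inferInstance, t, ?_, -(π₂ ≫ z ≫ (inl S.g).v k k (add_zero k)), ?_⟩
      · rw [← cancel_mono (S.f.f (k + 1 + 1))]
        have ht' := ht =≫ S.X₂.d (k + 1) (k + 1 + 1)
        simp only [Preadditive.comp_add, Preadditive.add_comp, Category.assoc, d_comp_d, comp_zero,
          add_zero, hy₁] at ht'
        rw [zero_comp, Category.assoc, ← Hom.comm, ← ht']
      · apply ext_to _ (k + 1) k (by lia)
        · simp only [Preadditive.add_comp, Category.assoc, liftShortComplex, lift_f_fst_f,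
            Preadditive.neg_comp, ← Hom.comm, inl_v_fst_f_assoc, ← ht, Preadditive.comp_add]
          abel
        · simp only [Preadditive.add_comp, Category.assoc, liftShortComplex, lift_f_snd_v,
            Preadditive.neg_comp, d_snd_v S.g k (k + 1) l rfl rfl, Preadditive.comp_sub,
            Preadditive.comp_neg, inl_v_fst_f_assoc, inl_v_snd_v_assoc, hz, Cochain.zero_v]
          simp
    exact isIso_of_mono_of_epi _

end CochainComplex.mappingCocone

namespace CochainComplex

open HomologicalComplex HomComplex

variable {C : Type*} [Category* C]

section Preadditive

variable [Preadditive C]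

namespace mappingCocone

variable {K₁ L₁ K₂ L₂ K₃ L₃ : CochainComplex C ℤ} (φ₁ : K₁ ⟶ L₁) (φ₂ : K₂ ⟶ L₂) (φ₃ : K₃ ⟶ L₃)
  [HasHomotopyCofiber φ₁] [HasHomotopyCofiber φ₂] [HasHomotopyCofiber φ₃]

lemma map_id : map φ₁ φ₁ (𝟙 _) (𝟙 _) (by simp) = 𝟙 _ := by
  ext p
  apply ext_to _ p (p + -1) rfl <;> simp

lemma map_comp (a : K₁ ⟶ K₂) (b : L₁ ⟶ L₂) (comm : φ₁ ≫ b = a ≫ φ₂)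
    (a' : K₂ ⟶ K₃) (b' : L₂ ⟶ L₃) (comm' : φ₂ ≫ b' = a' ≫ φ₃) :
    map φ₁ φ₃ (a ≫ a') (b ≫ b') (by rw [reassoc_of% comm, comm', Category.assoc]) =
      map φ₁ φ₂ a b comm ≫ map φ₂ φ₃ a' b' comm' := by
  ext p
  apply ext_to _ p (p + -1) rfl <;> simp

lemma ext_from (p q : ℤ) (hpq : p + -1 = q) {K L : CochainComplex C ℤ} {φ : K ⟶ L}
    [HasHomotopyCofiber φ] {A : C} {a b : (mappingCocone φ).X p ⟶ A}
    (h₁ : (inl φ).v p p (add_zero p) ≫ a = (inl φ).v p p (add_zero p) ≫ b)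
    (h₂ : (inr φ).1.v q p (by lia) ≫ a = (inr φ).1.v q p (by lia) ≫ b) : a = b := by
  rw [← Category.id_comp a, ← Category.id_comp b, ← id_X φ p q hpq]
  simp only [Preadditive.add_comp, Category.assoc, h₁, h₂]

section

variable (a : K₁ ⟶ K₂) (b : L₁ ⟶ L₂) (comm : φ₁ ≫ b = a ≫ φ₂)

@[simp]
lemma inl_v_map_f (p : ℤ) :
    (inl φ₁).v p p (add_zero p) ≫ (map φ₁ φ₂ a b comm).f p =
      a.f p ≫ (inl φ₂).v p p (add_zero p) := by
  apply ext_to _ p (p + -1) rfl <;> simp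

@[simp]
lemma inl_v_map_f_assoc (p : ℤ) {Z : C} (h : (mappingCocone φ₂).X p ⟶ Z) :
    (inl φ₁).v p p (add_zero p) ≫ (map φ₁ φ₂ a b comm).f p ≫ h =
      a.f p ≫ (inl φ₂).v p p (add_zero p) ≫ h := by
  rw [← Category.assoc, inl_v_map_f, Category.assoc]

@[simp]
lemma inr_v_map_f (p q : ℤ) (hpq : p + 1 = q) :
    (inr φ₁).1.v p q hpq ≫ (map φ₁ φ₂ a b comm).f q =
      b.f p ≫ (inr φ₂).1.v p q hpq := by
  apply ext_to _ q p (by lia) <;> simp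

@[simp]
lemma inr_v_map_f_assoc (p q : ℤ) (hpq : p + 1 = q) {Z : C} (h : (mappingCocone φ₂).X q ⟶ Z) :
    (inr φ₁).1.v p q hpq ≫ (map φ₁ φ₂ a b comm).f q ≫ h =
      b.f p ≫ (inr φ₂).1.v p q hpq ≫ h := by
  rw [← Category.assoc, inr_v_map_f, Category.assoc]

end

variable [HasBinaryBiproducts C]

/-- The degree `p` object of the mapping cocone as a biproduct. -/
noncomputable def XIsoBiprod {K L : CochainComplex C ℤ} (φ : K ⟶ L) (p q : ℤ)
    (hpq : p + -1 = q) : (mappingCocone φ).X p ≅ K.X p ⊞ L.X q where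
  hom := biprod.lift ((fst φ).f p) ((snd φ).v p q hpq)
  inv := biprod.desc ((inl φ).v p p (add_zero p)) ((inr φ).1.v q p (by lia))
  hom_inv_id := by simp [biprod.lift_desc, id_X]
  inv_hom_id := by ext <;> simp

end mappingCocone

/-- The complex with zero differential obtained by applying a functor to each of
the objects `K.X n`. -/
abbrev gradedObj (Φ : C ⥤ C) (K : CochainComplex C ℤ) : CochainComplex C ℤ where
  X n := Φ.obj (K.X n)
  d _ _ := 0

/-- The functoriality of `gradedObj`. -/
def gradedMap (Φ : C ⥤ C) {K L : CochainComplex C ℤ} (f : K ⟶ L) :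
    gradedObj Φ K ⟶ gradedObj Φ L where
  f n := Φ.map (f.f n)

variable (Φ : C ⥤ C)

lemma gradedMap_f {K L : CochainComplex C ℤ} (f : K ⟶ L) (n : ℤ) :
    (gradedMap Φ f).f n = Φ.map (f.f n) := rfl

lemma gradedMap_id (K : CochainComplex C ℤ) : gradedMap Φ (𝟙 K) = 𝟙 _ := by
  ext
  simp [gradedMap_f]

lemma gradedMap_comp {K L M : CochainComplex C ℤ} (f : K ⟶ L) (g : L ⟶ M) :
    gradedMap Φ (f ≫ g) = gradedMap Φ f ≫ gradedMap Φ g := by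
  ext
  simp [gradedMap_f]

variable {Φ}

/-- The cochain induced by a natural transformation `𝟭 C ⟶ Φ`. -/
def toGraded (η : 𝟭 C ⟶ Φ) (K : CochainComplex C ℤ) : Cochain K (gradedObj Φ K) 0 :=
  Cochain.ofHoms (fun n ↦ η.app (K.X n))

/-- The cochain induced by a natural transformation `Φ ⟶ 𝟭 C`. -/
def fromGraded (ε : Φ ⟶ 𝟭 C) (K : CochainComplex C ℤ) : Cochain (gradedObj Φ K) K 0 :=
  Cochain.ofHoms (fun n ↦ ε.app (K.X n))

@[simp]
lemma toGraded_v (η : 𝟭 C ⟶ Φ) (K : CochainComplex C ℤ) (n : ℤ) :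
    (toGraded η K).v n n (add_zero n) = η.app (K.X n) := Cochain.ofHoms_v _ _

@[simp]
lemma fromGraded_v (ε : Φ ⟶ 𝟭 C) (K : CochainComplex C ℤ) (n : ℤ) :
    (fromGraded ε K).v n n (add_zero n) = ε.app (K.X n) := Cochain.ofHoms_v _ _

lemma toGraded_naturality (η : 𝟭 C ⟶ Φ) {K L : CochainComplex C ℤ} (f : K ⟶ L) :
    (toGraded η K).comp (Cochain.ofHom (gradedMap Φ f)) (add_zero 0) =
      (Cochain.ofHom f).comp (toGraded η L) (add_zero 0) := by
  ext n
  simpa [gradedMap_f] using (η.naturality (f.f n)).symm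

lemma fromGraded_naturality (ε : Φ ⟶ 𝟭 C) {K L : CochainComplex C ℤ} (f : K ⟶ L) :
    (Cochain.ofHom (gradedMap Φ f)).comp (fromGraded ε L) (add_zero 0) =
      (fromGraded ε K).comp (Cochain.ofHom f) (add_zero 0) := by
  ext n
  simp [gradedMap_f]

variable [HasBinaryBiproducts C]

section

variable (Φ)

/-- The functoriality of the cone of the identity of `gradedObj Φ K`. -/
noncomputable def gradedConeMap {K L : CochainComplex C ℤ} (f : K ⟶ L) :
    mappingCone (𝟙 (gradedObj Φ K)) ⟶ mappingCone (𝟙 (gradedObj Φ L)) :=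
  mappingCone.map _ _ (gradedMap Φ f) (gradedMap Φ f) (by simp)

lemma gradedConeMap_id (K : CochainComplex C ℤ) : gradedConeMap Φ (𝟙 K) = 𝟙 _ := by
  simp only [gradedConeMap, gradedMap_id, mappingCone.map_id]

lemma gradedConeMap_comp {K L M : CochainComplex C ℤ} (f : K ⟶ L) (g : L ⟶ M) :
    gradedConeMap Φ (f ≫ g) = gradedConeMap Φ f ≫ gradedConeMap Φ g := by
  simp only [gradedConeMap, gradedMap_comp, ← mappingCone.map_comp]

/-- The functoriality of the cocone of the identity of `gradedObj Φ K`. -/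
noncomputable def gradedCoconeMap {K L : CochainComplex C ℤ} (f : K ⟶ L) :
    mappingCocone (𝟙 (gradedObj Φ K)) ⟶ mappingCocone (𝟙 (gradedObj Φ L)) :=
  mappingCocone.map _ _ (gradedMap Φ f) (gradedMap Φ f) (by simp)

lemma gradedCoconeMap_id (K : CochainComplex C ℤ) : gradedCoconeMap Φ (𝟙 K) = 𝟙 _ := by
  simp only [gradedCoconeMap, gradedMap_id, mappingCocone.map_id]

lemma gradedCoconeMap_comp {K L M : CochainComplex C ℤ} (f : K ⟶ L) (g : L ⟶ M) :
    gradedCoconeMap Φ (f ≫ g) = gradedCoconeMap Φ f ≫ gradedCoconeMap Φ g := by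
  simp only [gradedCoconeMap, gradedMap_comp, ← mappingCocone.map_comp]

end

/-- The morphism to the cone of the identity of the graded object. -/
noncomputable def toGradedCone (η : 𝟭 C ⟶ Φ) (K : CochainComplex C ℤ) :
    K ⟶ mappingCone (𝟙 (gradedObj Φ K)) :=
  mappingCone.lift _ (Cocycle.mk (-δ 0 1 (toGraded η K)) 2 rfl (by simp [δ_δ]))
    (toGraded η K) (by simp [Cocycle.mk])

lemma toGradedCone_naturality (η : 𝟭 C ⟶ Φ) {K L : CochainComplex C ℤ} (f : K ⟶ L) :
    toGradedCone η K ≫ gradedConeMap Φ f = f ≫ toGradedCone η L := by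
  ext n
  apply mappingCone.ext_to _ n (n + 1) rfl
  · simp only [toGradedCone, gradedConeMap, mappingCone.map, comp_f, Category.assoc]
    simp [mappingCone.desc_f _ _ _ _ n (n + 1) rfl]
    exact congrArg _ (η.naturality (f.f (n + 1))).symm
  · have h := Cochain.congr_v (toGraded_naturality η f) n n (add_zero n)
    simp only [Cochain.comp_zero_cochain_v, Cochain.ofHom_v] at h
    simp only [toGradedCone, gradedConeMap, mappingCone.map, comp_f, Category.assoc]
    simp [mappingCone.desc_f _ _ _ _ n (n + 1) rfl, - toGraded_v, h]

/-- The morphism from the cocone of the identity of the graded object. -/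
noncomputable def fromGradedCocone (ε : Φ ⟶ 𝟭 C) (K : CochainComplex C ℤ) :
    mappingCocone (𝟙 (gradedObj Φ K)) ⟶ K :=
  mappingCocone.desc _ (fromGraded ε K)
    (Cocycle.mk (-δ 0 1 (fromGraded ε K)) 2 rfl (by simp [δ_δ])) (by simp [Cocycle.mk])

lemma fromGradedCocone_naturality (ε : Φ ⟶ 𝟭 C) {K L : CochainComplex C ℤ} (f : K ⟶ L) :
    gradedCoconeMap Φ f ≫ fromGradedCocone ε L = fromGradedCocone ε K ≫ f := by
  ext n
  apply mappingCocone.ext_from n (n + -1) rfl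
  · have h := Cochain.congr_v (fromGraded_naturality ε f) n n (add_zero n)
    simp only [Cochain.comp_zero_cochain_v, Cochain.ofHom_v] at h
    simp [fromGradedCocone, gradedCoconeMap, - fromGraded_v, h]
  · simp [fromGradedCocone, gradedCoconeMap]
    simp [gradedMap_f]

end Preadditive

section Abelian

variable [Abelian C] {Φ : C ⥤ C}

lemma mono_toGradedCone (η : 𝟭 C ⟶ Φ) (hη : ∀ X, Mono (η.app X)) (K : CochainComplex C ℤ) :
    Mono (toGradedCone η K) := by
  have (n : ℤ) : Mono ((toGradedCone η K).f n) := by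
    have h : (toGradedCone η K).f n ≫ (mappingCone.snd _).v n n (add_zero n) =
        η.app (K.X n) := by
      simp [toGradedCone]
    have : Mono ((toGradedCone η K).f n ≫ (mappingCone.snd _).v n n (add_zero n)) := by
      rw [h]
      exact hη (K.X n)
    exact mono_of_mono _ ((mappingCone.snd _).v n n (add_zero n))
  exact HomologicalComplex.mono_of_mono_f _ this

lemma epi_fromGradedCocone (ε : Φ ⟶ 𝟭 C) (hε : ∀ X, Epi (ε.app X)) (K : CochainComplex C ℤ) :
    Epi (fromGradedCocone ε K) := by
  have (n : ℤ) : Epi ((fromGradedCocone ε K).f n) := by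
    have h : (mappingCocone.inl _).v n n (add_zero n) ≫ (fromGradedCocone ε K).f n =
        ε.app (K.X n) := by
      simp [fromGradedCocone]
    have : Epi ((mappingCocone.inl _).v n n (add_zero n) ≫ (fromGradedCocone ε K).f n) := by
      rw [h]
      exact hε (K.X n)
    exact epi_of_epi ((mappingCocone.inl _).v n n (add_zero n)) _
  exact HomologicalComplex.epi_of_epi_f _ this

/-- The short exact sequence `0 ⟶ K ⟶ mappingCone (𝟙 (gradedObj Φ K)) ⟶ cokernel ⟶ 0`. -/
noncomputable abbrev rightResolutionShortComplex (η : 𝟭 C ⟶ Φ) (K : CochainComplex C ℤ) :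
    ShortComplex (CochainComplex C ℤ) :=
  ShortComplex.mk (toGradedCone η K) (cokernel.π _) (cokernel.condition _)

/-- The functoriality of `rightResolutionShortComplex`. -/
noncomputable abbrev rightResolutionShortComplexMap (η : 𝟭 C ⟶ Φ) {K L : CochainComplex C ℤ}
    (f : K ⟶ L) : rightResolutionShortComplex η K ⟶ rightResolutionShortComplex η L where
  τ₁ := f
  τ₂ := gradedConeMap Φ f
  τ₃ := cokernel.map _ _ f (gradedConeMap Φ f) (toGradedCone_naturality η f)
  comm₁₂ := (toGradedCone_naturality η f).symm
  comm₂₃ := (cokernel.π_desc _ _ _).symm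

/-- The short exact sequence `0 ⟶ kernel ⟶ mappingCocone (𝟙 (gradedObj Φ K)) ⟶ K ⟶ 0`. -/
noncomputable abbrev leftResolutionShortComplex (ε : Φ ⟶ 𝟭 C) (K : CochainComplex C ℤ) :
    ShortComplex (CochainComplex C ℤ) :=
  ShortComplex.mk (kernel.ι _) (fromGradedCocone ε K) (kernel.condition _)

/-- The functoriality of `leftResolutionShortComplex`. -/
noncomputable abbrev leftResolutionShortComplexMap (ε : Φ ⟶ 𝟭 C) {K L : CochainComplex C ℤ}
    (f : K ⟶ L) : leftResolutionShortComplex ε K ⟶ leftResolutionShortComplex ε L where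
  τ₁ := kernel.map _ _ (gradedCoconeMap Φ f) f (fromGradedCocone_naturality ε f).symm
  τ₂ := gradedCoconeMap Φ f
  τ₃ := f
  comm₁₂ := kernel.lift_ι _ _ _
  comm₂₃ := fromGradedCocone_naturality ε f

lemma shortExact_rightResolutionShortComplex (η : 𝟭 C ⟶ Φ) (hη : ∀ X, Mono (η.app X))
    (K : CochainComplex C ℤ) : (rightResolutionShortComplex η K).ShortExact where
  exact := ShortComplex.exact_cokernel _
  mono_f := mono_toGradedCone η hη K
  epi_g := coequalizer.π_epi

lemma shortExact_leftResolutionShortComplex (ε : Φ ⟶ 𝟭 C) (hε : ∀ X, Epi (ε.app X))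
    (K : CochainComplex C ℤ) : (leftResolutionShortComplex ε K).ShortExact where
  exact := ShortComplex.exact_kernel _
  mono_f := equalizer.ι_mono
  epi_g := epi_fromGradedCocone ε hε K

/-- The functorial right resolution attached to a natural transformation `𝟭 C ⟶ Φ`. -/
noncomputable def rightResolution (η : 𝟭 C ⟶ Φ) : CochainComplex C ℤ ⥤ CochainComplex C ℤ where
  obj K := mappingCocone (rightResolutionShortComplex η K).g
  map f := mappingCocone.map _ _ (rightResolutionShortComplexMap η f).τ₂
    (rightResolutionShortComplexMap η f).τ₃ (rightResolutionShortComplexMap η f).comm₂₃.symm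
  map_id K := by
    rw [← mappingCocone.map_id]
    congr 1
    · exact gradedConeMap_id Φ K
    · refine (cancel_epi (cokernel.π _)).1 ((cokernel.π_desc _ _ _).trans ?_)
      rw [gradedConeMap_id]
      exact (Category.id_comp _).trans (Category.comp_id _).symm
  map_comp f g := by
    rw [← mappingCocone.map_comp]
    congr 1
    · exact gradedConeMap_comp Φ f g
    · refine (cancel_epi (cokernel.π _)).1 ((cokernel.π_desc _ _ _).trans ?_)
      simp [gradedConeMap_comp]

/-- The functorial left resolution attached to a natural transformation `Φ ⟶ 𝟭 C`. -/
noncomputable def leftResolution (ε : Φ ⟶ 𝟭 C) : CochainComplex C ℤ ⥤ CochainComplex C ℤ where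
  obj K := mappingCone (leftResolutionShortComplex ε K).f
  map f := mappingCone.map _ _ (leftResolutionShortComplexMap ε f).τ₁
    (leftResolutionShortComplexMap ε f).τ₂ (leftResolutionShortComplexMap ε f).comm₁₂.symm
  map_id K := by
    rw [← mappingCone.map_id]
    congr 1
    · refine (cancel_mono (kernel.ι _)).1 ((kernel.lift_ι _ _ _).trans ?_)
      rw [gradedCoconeMap_id]
      exact (Category.comp_id _).trans (Category.id_comp _).symm
    · exact gradedCoconeMap_id Φ K
  map_comp f g := by
    rw [← mappingCone.map_comp]
    congr 1
    · refine (cancel_mono (kernel.ι _)).1 ((kernel.lift_ι _ _ _).trans ?_)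
      simp [gradedCoconeMap_comp]
    · exact gradedCoconeMap_comp Φ f g

/-- The natural morphism to the right resolution. -/
noncomputable def toRightResolution (η : 𝟭 C ⟶ Φ) : 𝟭 _ ⟶ rightResolution η where
  app K := mappingCocone.liftShortComplex (rightResolutionShortComplex η K)
  naturality _ _ f :=
    (mappingCocone.liftShortComplex_map (rightResolutionShortComplexMap η f)).symm

/-- The natural morphism from the left resolution. -/
noncomputable def fromLeftResolution (ε : Φ ⟶ 𝟭 C) : leftResolution ε ⟶ 𝟭 _ where
  app K := mappingCone.descShortComplex (leftResolutionShortComplex ε K)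
  naturality _ _ f :=
    mappingCone.map_descShortComplex _ _ (leftResolutionShortComplexMap ε f)

lemma quasiIso_toRightResolution_app (η : 𝟭 C ⟶ Φ) (hη : ∀ X, Mono (η.app X))
    (K : CochainComplex C ℤ) : QuasiIso ((toRightResolution η).app K) :=
  mappingCocone.quasiIso_liftShortComplex (shortExact_rightResolutionShortComplex η hη K)

lemma quasiIso_fromLeftResolution_app (ε : Φ ⟶ 𝟭 C) (hε : ∀ X, Epi (ε.app X))
    (K : CochainComplex C ℤ) : QuasiIso ((fromLeftResolution ε).app K) :=
  mappingCone.quasiIso_descShortComplex (shortExact_leftResolutionShortComplex ε hε K)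

end Abelian

end CochainComplex

namespace CategoryTheory

open CochainComplex HomologicalComplex

variable {𝒞 : Type*} [Category* 𝒞] [Preadditive 𝒞]
  {𝒜 : Type*} [Category* 𝒜] [Abelian 𝒜] (F : 𝒞 ⥤ 𝒜) [F.Additive] [F.Full] [F.Faithful]
  [HasDerivedCategory 𝒜] {Φ : 𝒜 ⥤ 𝒜}

/-- If a full subcategory contains a functorial target for monomorphisms, and is closed under
quotients and biproducts, then the derived category is a localization of its category of
cochain complexes. -/
lemma isLocalization_of_mono (η : 𝟭 𝒜 ⟶ Φ) (hη : ∀ X, Mono (η.app X))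
    (hΦ : ∀ X, F.essImage (Φ.obj X))
    (hquot : ∀ ⦃X Y : 𝒜⦄ (f : X ⟶ Y) [Epi f], F.essImage X → F.essImage Y)
    (hbiprod : ∀ ⦃X Y : 𝒜⦄, F.essImage X → F.essImage Y → F.essImage (X ⊞ Y)) :
    (F.mapHomologicalComplex (ComplexShape.up ℤ) ⋙ DerivedCategory.Q).IsLocalization
      ((HomologicalComplex.quasiIso 𝒜 (ComplexShape.up ℤ)).inverseImage
        (F.mapHomologicalComplex (ComplexShape.up ℤ))) := by
  refine isLocalization_of_functorial_right_resolutions F (toRightResolution η)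
    (fun K ↦ quasiIso_toRightResolution_app η hη K) (fun K n ↦ ?_)
  have h (n : ℤ) : F.essImage ((mappingCone (𝟙 (gradedObj Φ K))).X n) :=
    Functor.essImage.ofIso
      (homotopyCofiber.XIsoBiprod (𝟙 (gradedObj Φ K)) n (n + 1) rfl).symm
      (hbiprod (hΦ (K.X (n + 1))) (hΦ (K.X n)))
  have hc : F.essImage ((cokernel (toGradedCone η K)).X (n + -1)) :=
    hquot ((cokernel.π (toGradedCone η K)).f _) (h _)
  exact Functor.essImage.ofIso (mappingCocone.XIsoBiprod _ n (n + -1) rfl).symm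
    (hbiprod (h n) hc)

/-- If a full subcategory contains a functorial source for epimorphisms, and is closed under
subobjects and biproducts, then the derived category is a localization of its category of
cochain complexes. -/
lemma isLocalization_of_epi (ε : Φ ⟶ 𝟭 𝒜) (hε : ∀ X, Epi (ε.app X))
    (hΦ : ∀ X, F.essImage (Φ.obj X))
    (hsub : ∀ ⦃X Y : 𝒜⦄ (f : X ⟶ Y) [Mono f], F.essImage Y → F.essImage X)
    (hbiprod : ∀ ⦃X Y : 𝒜⦄, F.essImage X → F.essImage Y → F.essImage (X ⊞ Y)) :
    (F.mapHomologicalComplex (ComplexShape.up ℤ) ⋙ DerivedCategory.Q).IsLocalization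
      ((HomologicalComplex.quasiIso 𝒜 (ComplexShape.up ℤ)).inverseImage
        (F.mapHomologicalComplex (ComplexShape.up ℤ))) := by
  refine isLocalization_of_functorial_left_resolutions F (fromLeftResolution ε)
    (fun K ↦ quasiIso_fromLeftResolution_app ε hε K) (fun K n ↦ ?_)
  have h (n : ℤ) : F.essImage ((mappingCocone (𝟙 (gradedObj Φ K))).X n) :=
    Functor.essImage.ofIso (mappingCocone.XIsoBiprod _ n (n + -1) rfl).symm
      (hbiprod (hΦ (K.X n)) (hΦ (K.X (n + -1))))
  have hk : F.essImage ((kernel (fromGradedCocone ε K)).X (n + 1)) :=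
    hsub ((kernel.ι (fromGradedCocone ε K)).f _) (h _)
  exact Functor.essImage.ofIso
    (homotopyCofiber.XIsoBiprod (kernel.ι (fromGradedCocone ε K)) n (n + 1) rfl).symm
    (hbiprod hk (h n))

end CategoryTheory

/-- The combinatorial data attached to a tilting `(A, B)`-bimodule `T` which, as a left `A`-module,
is presented as the cokernel of a map `A (1 - e) ⟶ A e ⊕ (A e)^ι ρ`, with generators `τ₀` and
`τ j` and relation `∑ j, σ j • τ j = 0`. -/
structure TiltingPresentation (A B T ι : Type*) [Ring A] [Ring B] [AddCommGroup T] [Module A T]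
    [Fintype ι] where
  /-- The ring `B` acts on the right of `T` and identifies to the endomorphisms of `T`. -/
  act : B ≃+* (Module.End A T)ᵐᵒᵖ
  /-- an idempotent -/
  e : A
  /-- an idempotent matrix -/
  ρ : ι → ι → A
  /-- the relation -/
  σ : ι → A
  /-- the first generator -/
  τ₀ : T
  /-- the other generators -/
  τ : ι → T
  e_mul_e : e * e = e
  e_mul_ρ (i j : ι) : e * ρ i j = ρ i j
  ρ_mul_e (i j : ι) : ρ i j * e = ρ i j
  ρ_mul_ρ (i k : ι) : ∑ j, ρ i j * ρ j k = ρ i k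
  σ_mul_ρ (k : ι) : ∑ j, σ j * ρ j k = σ k
  e_mul_σ (j : ι) : e * σ j = 0
  e_smul_τ₀ : e • τ₀ = τ₀
  ρ_smul_τ (i : ι) : ∑ j, ρ i j • τ j = τ i
  σ_smul_τ : ∑ j, σ j • τ j = 0
  exists_eq (t : T) : ∃ (a₀ : A) (a : ι → A), t = a₀ • τ₀ + ∑ j, a j • τ j
  rel (a₀ : A) (a : ι → A) (h : a₀ • τ₀ + ∑ j, a j • τ j = 0) :
    a₀ * e = 0 ∧ ∃ c, ∀ k, ∑ j, a j * ρ j k = c * σ k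
  exists_decomp (a : A) : ∃ s : ι → A, (1 - e) * a * e = ∑ j, σ j * s j
  mono_σ (a : A) (h : ∀ j, a * σ j = 0) : a * (1 - e) = 0

namespace TiltingPresentation

variable {A B T ι : Type*} [Ring A] [Ring B] [AddCommGroup T] [Module A T] [Fintype ι]
  (D : TiltingPresentation A B T ι)
  {N N₁ N₂ N₃ N₄ : Type*} [AddCommGroup N] [Module A N] [AddCommGroup N₁] [Module A N₁]
  [AddCommGroup N₂] [Module A N₂] [AddCommGroup N₃] [Module A N₃] [AddCommGroup N₄] [Module A N₄]

attribute [simp] e_smul_τ₀ ρ_smul_τ σ_smul_τ e_mul_σ e_mul_ρ e_mul_e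

/-- The right action of `B` on `T`. -/
def R (b : B) : T →ₗ[A] T := (D.act b).unop

lemma R_one : D.R 1 = LinearMap.id := by simp [R]; rfl

lemma R_zero : D.R 0 = 0 := by simp [R]

lemma R_add (b c : B) : D.R (b + c) = D.R b + D.R c := by simp [R]

lemma R_mul (b c : B) : D.R (b * c) = D.R c ∘ₗ D.R b := by simp [R]; rfl

lemma R_injective : Function.Injective D.R :=
  MulOpposite.unop_injective.comp D.act.injective

lemma R_surjective : Function.Surjective D.R :=
  MulOpposite.unop_surjective.comp D.act.surjective

/-- The action of the idempotent matrix `ρ`. -/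
def mulρ (v : ι → N) : ι → N := fun i ↦ ∑ j, D.ρ i j • v j

/-- The action of the row matrix `σ`. -/
def mulσ (v : ι → N) : N := ∑ j, D.σ j • v j

@[simp]
lemma mulρ_mulρ (v : ι → N) : D.mulρ (D.mulρ v) = D.mulρ v := by
  ext i
  simp only [mulρ, Finset.smul_sum, smul_smul]
  rw [Finset.sum_comm]
  simp only [← Finset.sum_smul, D.ρ_mul_ρ]

@[simp]
lemma mulσ_mulρ (v : ι → N) : D.mulσ (D.mulρ v) = D.mulσ v := by
  simp only [mulρ, mulσ, Finset.smul_sum, smul_smul]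
  rw [Finset.sum_comm]
  simp only [← Finset.sum_smul, D.σ_mul_ρ]

@[simp]
lemma mulρ_sub (v w : ι → N) : D.mulρ (v - w) = D.mulρ v - D.mulρ w := by
  ext i
  simp [mulρ, smul_sub]

@[simp]
lemma mulσ_sub (v w : ι → N) : D.mulσ (v - w) = D.mulσ v - D.mulσ w := by
  simp [mulσ, smul_sub]

@[simp]
lemma mulσ_add (v w : ι → N) : D.mulσ (v + w) = D.mulσ v + D.mulσ w := by
  simp [mulσ, smul_add, Finset.sum_add_distrib]

@[simp]
lemma mulσ_zero : D.mulσ (0 : ι → N) = 0 := by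
  simp [mulσ]

lemma e_smul_mulρ (v : ι → N) (i : ι) : D.e • D.mulρ v i = D.mulρ v i := by
  simp [mulρ, Finset.smul_sum, smul_smul]

lemma e_smul_mulσ (v : ι → N) : D.e • D.mulσ v = 0 := by
  simp [mulσ, Finset.smul_sum, smul_smul]

lemma map_mulρ (p : N →ₗ[A] N₁) (v : ι → N) (i : ι) :
    p (D.mulρ v i) = D.mulρ (fun j ↦ p (v j)) i := by
  simp [mulρ]

lemma map_mulσ (p : N →ₗ[A] N₁) (v : ι → N) : p (D.mulσ v) = D.mulσ (fun j ↦ p (v j)) := by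
  simp [mulσ]

lemma mulρ_τ : D.mulρ D.τ = D.τ := by
  ext
  simp [mulρ]

lemma mulσ_τ : D.mulσ D.τ = 0 := D.σ_smul_τ

lemma e_smul_τ (i : ι) : D.e • D.τ i = D.τ i := by
  rw [← D.mulρ_τ, e_smul_mulρ]

lemma σ_mul_e (j : ι) : D.σ j * D.e = D.σ j := by
  rw [← D.σ_mul_ρ j]
  simp [Finset.sum_mul, mul_assoc, D.ρ_mul_e]

lemma hom_ext {φ ψ : T →ₗ[A] N} (h₀ : φ D.τ₀ = ψ D.τ₀) (h : ∀ j, φ (D.τ j) = ψ (D.τ j)) :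
    φ = ψ := by
  ext t
  obtain ⟨a₀, a, rfl⟩ := D.exists_eq t
  simp [h₀, h]

lemma exists_hom (v₀ : N) (v : ι → N) (hv₀ : D.e • v₀ = v₀) (hv : D.mulρ v = v)
    (hσ : D.mulσ v = 0) : ∃ φ : T →ₗ[A] N, φ D.τ₀ = v₀ ∧ ∀ j, φ (D.τ j) = v j := by
  let P : (A × (ι → A)) →ₗ[A] T := (LinearMap.toSpanSingleton A T D.τ₀).coprod
    (Fintype.linearCombination A D.τ)
  let Q : (A × (ι → A)) →ₗ[A] N := (LinearMap.toSpanSingleton A N v₀).coprod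
    (Fintype.linearCombination A v)
  have hP (x) : P x = x.1 • D.τ₀ + ∑ j, x.2 j • D.τ j := by
    simp [P, Fintype.linearCombination_apply]
  have hQ (x) : Q x = x.1 • v₀ + ∑ j, x.2 j • v j := by
    simp [Q, Fintype.linearCombination_apply]
  have hPQ : LinearMap.ker P ≤ LinearMap.ker Q := by
    intro x hx
    rw [LinearMap.mem_ker] at hx ⊢
    rw [hP] at hx
    obtain ⟨h₀, c, hc⟩ := D.rel _ _ hx
    rw [hQ]
    have h₁ : x.1 • v₀ = 0 := by rw [← hv₀, smul_smul, h₀, zero_smul]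
    have h₂ : ∑ j, x.2 j • v j = c • D.mulσ v := by
      conv_lhs => rw [← hv]
      simp only [mulρ, mulσ, Finset.smul_sum, smul_smul, ← hc, Finset.sum_smul]
      rw [Finset.sum_comm]
    rw [h₁, h₂, hσ, smul_zero, add_zero]
  have hPs : Function.Surjective P := fun t ↦ by
    obtain ⟨a₀, a, rfl⟩ := D.exists_eq t
    exact ⟨(a₀, a), hP _⟩
  let φ : T →ₗ[A] N := (LinearMap.ker P).liftQ Q hPQ ∘ₗ
    (P.quotKerEquivOfSurjective hPs).symm.toLinearMap
  have hφ (x) : φ (P x) = Q x := by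
    have : (P.quotKerEquivOfSurjective hPs).symm (P x) = Submodule.Quotient.mk x := by
      rw [LinearEquiv.symm_apply_eq]
      rfl
    simp [φ, this]
  classical
  refine ⟨φ, ?_, fun j ↦ ?_⟩
  · have := hφ (1, 0)
    simpa [hP, hQ] using this
  · have := hφ (0, Pi.single j 1)
    simpa [hP, hQ, Pi.single_apply] using this

/-- The linear map `T → N` which sends `τ₀` to `e • x` and `τ j` to `0`. -/
noncomputable def homOf (x : N) : T →ₗ[A] N :=
  (D.exists_hom (D.e • x) 0 (by simp [smul_smul]) (by ext; simp [mulρ]) (by simp)).choose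

@[simp]
lemma homOf_τ₀ (x : N) : D.homOf x D.τ₀ = D.e • x :=
  (D.exists_hom (D.e • x) 0 (by simp [smul_smul]) (by ext; simp [mulρ]) (by simp)).choose_spec.1

@[simp]
lemma homOf_τ (x : N) (j : ι) : D.homOf x (D.τ j) = 0 :=
  (D.exists_hom (D.e • x) 0 (by simp [smul_smul]) (by ext; simp [mulρ]) (by simp)).choose_spec.2 j

lemma comp_homOf (p : N →ₗ[A] N₁) (x : N) : p ∘ₗ D.homOf x = D.homOf (p x) :=
  D.hom_ext (by simp) (by simp)

/-- The element of `B` which corresponds to the endomorphism `D.homOf t` of `T`. -/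
noncomputable def β (t : T) : B := (D.R_surjective (D.homOf t)).choose

@[simp]
lemma R_β (t : T) : D.R (D.β t) = D.homOf t := (D.R_surjective (D.homOf t)).choose_spec

/-- The modules `N` which are generated by `e N`. -/
def IsTorsion (N : Type*) [AddCommGroup N] [Module A N] : Prop :=
  ∀ x : N, ∃ v : ι → N, D.mulσ v = (1 - D.e) • x

variable {D} in
lemma IsTorsion.exists_mulρ (hN : D.IsTorsion N) (x : N) :
    ∃ v : ι → N, D.mulρ v = v ∧ D.mulσ v = (1 - D.e) • x := by
  obtain ⟨v, hv⟩ := hN x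
  exact ⟨D.mulρ v, by simp, by simpa⟩

variable {D} in
lemma IsTorsion.of_surjective (hN : D.IsTorsion N) (p : N →ₗ[A] N₁) (hp : Function.Surjective p) :
    D.IsTorsion N₁ := fun x ↦ by
  obtain ⟨x, rfl⟩ := hp x
  obtain ⟨v, hv⟩ := hN x
  exact ⟨fun j ↦ p (v j), by rw [← map_mulσ, hv, map_smul]⟩

lemma isTorsion_T : D.IsTorsion T := fun t ↦ by
  have key (a : A) (t : T) (ht : D.e • t = t) : ∃ v : ι → T, D.mulσ v = (1 - D.e) • a • t := by
    obtain ⟨s, hs⟩ := D.exists_decomp a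
    refine ⟨fun j ↦ s j • t, ?_⟩
    simp only [mulσ, smul_smul, ← Finset.sum_smul, ← hs]
    rw [mul_smul _ D.e, ht]
  obtain ⟨a₀, a, rfl⟩ := D.exists_eq t
  obtain ⟨v₀, h₀⟩ := key a₀ D.τ₀ D.e_smul_τ₀
  choose v hv using fun j ↦ key (a j) (D.τ j) (D.e_smul_τ j)
  refine ⟨v₀ + fun k ↦ ∑ j, v j k, ?_⟩
  rw [mulσ_add, h₀, smul_add]
  congr 1
  simp only [mulσ, Finset.smul_sum] at hv ⊢
  rw [Finset.sum_comm]
  exact Finset.sum_congr rfl (fun j _ ↦ hv j)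

lemma exists_lift (p : N →ₗ[A] N₁) (hp : D.IsTorsion (LinearMap.ker p)) (φ : T →ₗ[A] N₁)
    (hφ : ∀ t, ∃ x, p x = φ t) : ∃ ψ : T →ₗ[A] N, p ∘ₗ ψ = φ := by
  obtain ⟨x₀, hx₀⟩ := hφ D.τ₀
  choose x hx using fun j ↦ hφ (D.τ j)
  have hs : p (D.mulσ x) = 0 := by
    simp only [map_mulσ, hx]
    rw [← map_mulσ, mulσ_τ, map_zero]
  obtain ⟨w, hw, hw'⟩ := hp.exists_mulρ ⟨D.mulσ x, hs⟩
  replace hw' : D.mulσ (fun j ↦ (w j).1) = D.mulσ x := by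
    have := congrArg Subtype.val hw'
    rw [← Submodule.coe_subtype, map_mulσ] at this
    simpa [sub_smul, e_smul_mulσ] using this
  replace hw (i) : D.mulρ (fun j ↦ (w j).1) i = (w i).1 := by
    have := congrArg Subtype.val (congrFun hw i)
    rwa [← Submodule.coe_subtype, map_mulρ] at this
  replace hw := funext hw
  obtain ⟨ψ, hψ₀, hψ⟩ := D.exists_hom (D.e • x₀) (D.mulρ x - fun j ↦ (w j).1)
    (by simp [smul_smul]) (by simp [hw]) (by simp [hw'])
  refine ⟨ψ, D.hom_ext ?_ (fun j ↦ ?_)⟩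
  · simp [hψ₀, hx₀, ← map_smul]
  · have : p (D.mulρ x j) = φ (D.τ j) := by
      simp only [map_mulρ, hx]
      rw [← map_mulρ, mulρ_τ]
    simp [hψ, this]

lemma exact_comp (f : N₁ →ₗ[A] N₂) (g : N₂ →ₗ[A] N₃) (h : N₃ →ₗ[A] N₄)
    (hN₁ : D.IsTorsion N₁) (hfg : Function.Exact f g) (hgh : Function.Exact g h)
    (φ : T →ₗ[A] N₃) (hφ : h ∘ₗ φ = 0) : ∃ ψ : T →ₗ[A] N₂, g ∘ₗ ψ = φ := by
  refine D.exists_lift g ?_ φ (fun t ↦ (hgh _).1 (LinearMap.congr_fun hφ t))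
  refine hN₁.of_surjective (f.codRestrict _ (fun x ↦ (hfg _).2 ⟨x, rfl⟩)) ?_
  rintro ⟨y, hy⟩
  obtain ⟨x, hx⟩ := (hfg y).1 hy
  exact ⟨x, Subtype.ext hx⟩

lemma exact_of_exact_comp (f : N₁ →ₗ[A] N₂) (g : N₂ →ₗ[A] N₃) (h : N₃ →ₗ[A] N₄)
    (hN₂ : D.IsTorsion N₂) (hgf : g ∘ₗ f = 0) (hhg : h ∘ₗ g = 0)
    (hfg : ∀ φ : T →ₗ[A] N₂, g ∘ₗ φ = 0 → ∃ ψ : T →ₗ[A] N₁, f ∘ₗ ψ = φ)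
    (hgh : ∀ φ : T →ₗ[A] N₃, h ∘ₗ φ = 0 → ∃ ψ : T →ₗ[A] N₂, g ∘ₗ ψ = φ) :
    Function.Exact f g := by
  have key (x : N₂) (hx : g x = 0) : ∃ y, f y = D.e • x := by
    obtain ⟨ψ, hψ⟩ := hfg (D.homOf x) (by rw [comp_homOf, hx]; exact D.hom_ext (by simp) (by simp))
    exact ⟨ψ D.τ₀, by simpa using LinearMap.congr_fun hψ D.τ₀⟩
  intro x
  refine ⟨fun hx ↦ ?_, ?_⟩
  · obtain ⟨y₀, hy₀⟩ := key x hx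
    obtain ⟨v, hv, hσ⟩ := hN₂.exists_mulρ x
    obtain ⟨ζ, hζ₀, hζ⟩ := D.exists_hom (0 : N₃) (fun j ↦ g (v j)) (by simp)
      (by ext i; rw [← map_mulρ, hv]) (by rw [← map_mulσ, hσ, map_smul, hx, smul_zero])
    obtain ⟨ζ', rfl⟩ := hgh ζ (D.hom_ext (by simp [hζ₀])
      (fun j ↦ by simpa [hζ] using LinearMap.congr_fun hhg (v j)))
    choose y hy using fun j ↦ key (v j - ζ' (D.τ j)) (by
      rw [map_sub, sub_eq_zero, ← hζ]
      rfl)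
    replace hy (j) : f (y j) = v j - ζ' (D.τ j) := by
      rw [hy, smul_sub, ← map_smul, e_smul_τ]
      congr 1
      rw [← hv, e_smul_mulρ]
    refine ⟨y₀ + D.mulσ y, ?_⟩
    have : D.mulσ (fun j ↦ v j - ζ' (D.τ j)) = D.mulσ v := by
      change D.mulσ (v - fun j ↦ ζ' (D.τ j)) = _
      rw [mulσ_sub, ← map_mulσ, mulσ_τ, map_zero, sub_zero]
    rw [map_add, hy₀, map_mulσ]
    simp only [hy]
    rw [this, hσ, ← add_smul]
    simp
  · rintro ⟨y, rfl⟩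
    exact LinearMap.congr_fun hgf y

lemma IsTorsion.hom_ext {D : TiltingPresentation A B T ι} (hN : D.IsTorsion N) {f g : N →ₗ[A] N₁}
    (h : ∀ φ : T →ₗ[A] N, f ∘ₗ φ = g ∘ₗ φ) : f = g := by
  have key (x : N) : f (D.e • x) = g (D.e • x) := by
    simpa using LinearMap.congr_fun (h (D.homOf x)) D.τ₀
  ext x
  obtain ⟨v, hv, hσ⟩ := hN.exists_mulρ x
  have hv' : (fun j ↦ f (v j)) = (fun j ↦ g (v j)) := by
    ext j
    rw [← hv, ← e_smul_mulρ, key]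
  have h₂ : f ((1 - D.e) • x) = g ((1 - D.e) • x) := by
    rw [← hσ, map_mulσ, map_mulσ, hv']
  have : x = D.e • x + (1 - D.e) • x := by simp [← add_smul]
  rw [this, map_add, map_add, key, h₂]

lemma IsTorsion.exists_of_hom_map {D : TiltingPresentation A B T ι} (hN : D.IsTorsion N)
    (Ψ : (T →ₗ[A] N) →+ (T →ₗ[A] N₁)) (hΨ : ∀ b φ, Ψ (φ ∘ₗ D.R b) = Ψ φ ∘ₗ D.R b) :
    ∃ f : N →ₗ[A] N₁, ∀ φ, Ψ φ = f ∘ₗ φ := by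
  let h (x : N) : N₁ := Ψ (D.homOf x) D.τ₀
  have h_eq (x y : N) (hxy : D.e • x = D.e • y) : h x = h y := by
    have : D.homOf x = D.homOf y := D.hom_ext (by simpa) (by simp)
    simp [h, this]
  have h_add (x y : N) : h (x + y) = h x + h y := by
    have : D.homOf (x + y) = D.homOf x + D.homOf y := D.hom_ext (by simp) (by simp)
    simp [h, this]
  have h_zero : h 0 = 0 := by simpa using h_add 0 0
  have e_h (x : N) : D.e • h x = h x := by simp [h, ← map_smul]
  have h_smul (a : A) (x : N) : h (a • D.e • x) = D.e • a • h x := by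
    have : D.homOf (a • D.e • x) = D.homOf x ∘ₗ D.R (D.β (a • D.τ₀)) :=
      D.hom_ext (by simp) (by simp)
    change Ψ (D.homOf _) D.τ₀ = _
    rw [this, hΨ]
    simp [h]
  have h_sum (w : ι → N) : h (∑ j, w j) = ∑ j, h (w j) :=
    map_sum (AddMonoidHom.mk' h h_add) w Finset.univ
  have h_ζ (ζ : T →ₗ[A] N) (j : ι) : Ψ ζ (D.τ j) = h (ζ (D.τ j)) := by
    have : D.homOf (ζ (D.τ j)) = ζ ∘ₗ D.R (D.β (D.τ j)) := D.hom_ext (by simp) (by simp)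
    change _ = Ψ (D.homOf _) D.τ₀
    rw [this, hΨ]
    simp [e_smul_τ]
  have h_ζ₀ (ζ : T →ₗ[A] N) : Ψ ζ D.τ₀ = h (ζ D.τ₀) := by
    have : D.homOf (ζ D.τ₀) = ζ ∘ₗ D.R (D.β D.τ₀) :=
      D.hom_ext (by simp [← map_smul]) (by simp)
    change _ = Ψ (D.homOf _) D.τ₀
    rw [this, hΨ]
    simp
  have h_mulσ (w : ι → N) (hw : D.mulσ w = 0) : D.mulσ (fun j ↦ h (w j)) = 0 := by
    have h₁ (i : ι) : h (D.mulρ w i) = D.mulρ (fun j ↦ h (w j)) i := by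
      simp only [mulρ, h_sum]
      refine Finset.sum_congr rfl (fun j _ ↦ ?_)
      rw [← D.ρ_mul_e, mul_smul, h_smul, smul_smul, D.e_mul_ρ, D.ρ_mul_e]
    obtain ⟨ζ, _, hζ⟩ := D.exists_hom 0 (D.mulρ w) (by simp) (by simp) (by simpa)
    rw [← mulσ_mulρ]
    have h₂ : D.mulρ (fun j ↦ h (w j)) = fun j ↦ Ψ ζ (D.τ j) := by
      ext j
      rw [h_ζ, hζ, h₁]
    rw [h₂, ← map_mulσ, mulσ_τ, map_zero]
  let Γ : Submodule A (N × N₁) := Submodule.span A (Set.range (fun v ↦ (D.e • v, h v)))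
  have hΓ (z) (hz : z ∈ Γ) (a : A) : h (a • z.1) = D.e • a • z.2 ∧
      ∃ w : ι → N, D.mulσ w = (1 - D.e) • a • z.1 ∧
        D.mulσ (fun j ↦ h (w j)) = (1 - D.e) • a • z.2 := by
    induction hz using Submodule.span_induction generalizing a with
    | mem z hz =>
      obtain ⟨v, rfl⟩ := hz
      obtain ⟨s, hs⟩ := D.exists_decomp a
      refine ⟨h_smul a v, fun j ↦ s j • D.e • v, ?_, ?_⟩
      · simp only [mulσ, smul_smul, ← mul_assoc, ← Finset.sum_mul, ← Finset.sum_smul, ← hs]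
        rw [mul_assoc _ D.e, D.e_mul_e]
      · simp only [mulσ, h_smul]
        simp only [smul_smul, D.σ_mul_e, ← mul_assoc, ← Finset.sum_smul, ← hs]
        rw [mul_smul _ D.e, e_h]
    | zero => exact ⟨by simp [h_zero], 0, by simp, by simp [mulσ, h_zero]⟩
    | add y z _ _ hy hz =>
      obtain ⟨hy, v, hv, hv'⟩ := hy a
      obtain ⟨hz, w, hw, hw'⟩ := hz a
      refine ⟨by simp [h_add, hy, hz], v + w, by simp [hv, hw], ?_⟩
      have : (fun j ↦ h ((v + w) j)) = (fun j ↦ h (v j)) + fun j ↦ h (w j) := by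
        ext; simp [h_add]
      rw [this, mulσ_add, hv', hw', Prod.snd_add, smul_add, smul_add]
    | smul c z _ hz =>
      simpa [smul_smul, mul_assoc] using hz (a * c)
  have hΓ₀ (y : N₁) (hy : (0, y) ∈ Γ) : y = 0 := by
    obtain ⟨h₁, w, hw, hw'⟩ := hΓ _ hy 1
    simp only [smul_zero, h_zero, one_smul] at h₁ hw hw'
    rw [h_mulσ w hw] at hw'
    have : y = D.e • y + (1 - D.e) • y := by simp [← add_smul]
    rw [this, ← h₁, ← hw', add_zero]
  have hmem (v : N) : (D.e • v, h v) ∈ Γ := Submodule.subset_span ⟨v, rfl⟩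
  have hbij : Function.Bijective (LinearMap.fst A N N₁ ∘ₗ Γ.subtype) := by
    refine ⟨?_, fun x ↦ ?_⟩
    · rw [injective_iff_map_eq_zero]
      rintro ⟨⟨x, y⟩, hxy⟩ (rfl : x = 0)
      simp [hΓ₀ y hxy]
    · obtain ⟨v, hv, hσ⟩ := hN.exists_mulρ x
      refine ⟨⟨(D.e • x, h x) + ∑ j, D.σ j • (D.e • v j, h (v j)),
        add_mem (hmem x) (sum_mem fun j _ ↦ Γ.smul_mem _ (hmem _))⟩, ?_⟩
      have : ∑ j, D.σ j • D.e • v j = (1 - D.e) • x := by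
        rw [← hσ]
        simp [mulσ, smul_smul, D.σ_mul_e]
      simp [Prod.fst_sum, this, ← add_smul]
  let E := LinearEquiv.ofBijective _ hbij
  let f : N →ₗ[A] N₁ := LinearMap.snd A N N₁ ∘ₗ Γ.subtype ∘ₗ E.symm.toLinearMap
  have hf (z) (hz : z ∈ Γ) : f z.1 = z.2 := by
    have : E.symm z.1 = ⟨z, hz⟩ := by
      rw [LinearEquiv.symm_apply_eq]
      rfl
    simp [f, this]
  have hf' (x : N) : f (D.e • x) = h x := hf _ (hmem x)
  refine ⟨f, fun φ ↦ D.hom_ext ?_ (fun j ↦ ?_)⟩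
  · rw [h_ζ₀, ← hf', ← map_smul, e_smul_τ₀]
    rfl
  · rw [h_ζ, ← hf', ← map_smul, e_smul_τ]
    rfl

end TiltingPresentation

namespace TiltingPresentation

section

variable {A B T ι : Type*} [Ring A] [Ring B] [AddCommGroup T] [Module A T] [Fintype ι]
  (D : TiltingPresentation A B T ι)
  (N : Type*) [AddCommGroup N] [Module A N] {N' N'' : Type*} [AddCommGroup N'] [Module B N']
  [AddCommGroup N''] [Module B N'']

/-- The abelian group of `A`-linear maps `T → N`, as a module over `B`. -/
@[nolint unusedArguments]
def Hom (_ : TiltingPresentation A B T ι) (N : Type*) [AddCommGroup N] [Module A N] :=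
  T →ₗ[A] N

instance : AddCommGroup (D.Hom N) := inferInstanceAs (AddCommGroup (T →ₗ[A] N))

instance : Module B (D.Hom N) where
  smul b φ := LinearMap.comp (φ : T →ₗ[A] N) (D.R b)
  one_smul φ := by
    change LinearMap.comp (φ : T →ₗ[A] N) (D.R 1) = φ
    rw [D.R_one]
    rfl
  mul_smul b c φ := by
    change LinearMap.comp (φ : T →ₗ[A] N) (D.R (b * c)) = _
    rw [D.R_mul]
    rfl
  smul_zero b := LinearMap.zero_comp _
  smul_add b φ ψ := LinearMap.add_comp _ _ _
  add_smul b c φ := by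
    change LinearMap.comp (φ : T →ₗ[A] N) (D.R (b + c)) = _
    rw [D.R_add]
    exact LinearMap.comp_add _ _ _
  zero_smul φ := by
    change LinearMap.comp (φ : T →ₗ[A] N) (D.R 0) = _
    rw [D.R_zero]
    exact LinearMap.comp_zero _

/-- The modules over `B` which are cogenerated by the modules `D.Hom N`. -/
def IsTorsionFree (N' : Type*) [AddCommGroup N'] [Module B N'] : Prop :=
  ∀ x : N', (∀ b : B, D.β D.τ₀ • b • x = 0) → x = 0

lemma isTorsionFree_hom : D.IsTorsionFree (D.Hom N) := fun (φ : T →ₗ[A] N) hφ ↦ by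
  have key (b : B) : φ (D.R b D.τ₀) = 0 := by
    have : (φ ∘ₗ D.R b) (D.R (D.β D.τ₀) D.τ₀) = 0 :=
      LinearMap.congr_fun (hφ b) D.τ₀
    simpa using this
  exact D.hom_ext (ψ := (0 : T →ₗ[A] N)) (by simpa [R_one] using key 1)
    (fun j ↦ by simpa [e_smul_τ] using key (D.β (D.τ j)))

variable {D} in
lemma IsTorsionFree.of_injective (h : D.IsTorsionFree N') (p : N'' →ₗ[B] N')
    (hp : Function.Injective p) : D.IsTorsionFree N'' := fun x hx ↦
  (injective_iff_map_eq_zero p).1 hp x (h _ fun b ↦ by rw [← map_smul, ← map_smul, hx, map_zero])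

lemma isTorsionFree_self : D.IsTorsionFree B :=
  (D.isTorsionFree_hom T).of_injective
    { toFun b := (D.R b : T →ₗ[A] T)
      map_add' := D.R_add
      map_smul' := D.R_mul } D.R_injective

lemma isTorsionFree_finsupp (I : Type*) : D.IsTorsionFree (I →₀ B) := fun x hx ↦ by
  ext i
  exact D.isTorsionFree_self _ (fun b ↦ DFunLike.congr_fun (hx b) i)

variable {D} in
lemma IsTorsionFree.prod (h : D.IsTorsionFree N') (h' : D.IsTorsionFree N'') :
    D.IsTorsionFree (N' × N'') := fun _ hx ↦
  Prod.ext (h _ fun b ↦ congrArg Prod.fst (hx b)) (h' _ fun b ↦ congrArg Prod.snd (hx b))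

variable {N} in
lemma isTorsion_iSup_range {κ : Type*} (ψ : κ → T →ₗ[A] N) :
    D.IsTorsion ↥(⨆ k, LinearMap.range (ψ k)) := by
  rintro ⟨x, hx⟩
  suffices ∃ v : ι → N, (∀ j, v j ∈ ⨆ k, LinearMap.range (ψ k)) ∧
      D.mulσ v = (1 - D.e) • x by
    obtain ⟨v, hv, hσ⟩ := this
    exact ⟨fun j ↦ ⟨v j, hv j⟩, Subtype.ext (by
      rw [← Submodule.subtype_apply, map_mulσ]
      exact hσ)⟩
  induction hx using Submodule.iSup_induction' with
  | mem k x hx =>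
    obtain ⟨t, rfl⟩ := hx
    obtain ⟨v, hv⟩ := D.isTorsion_T t
    exact ⟨fun j ↦ ψ k (v j), fun j ↦ Submodule.mem_iSup_of_mem k ⟨_, rfl⟩, by
      rw [← map_mulσ, hv, map_smul]⟩
  | zero => exact ⟨0, fun _ ↦ zero_mem _, by simp⟩
  | add x y _ _ hx hy =>
    obtain ⟨v, hv, hv'⟩ := hx
    obtain ⟨w, hw, hw'⟩ := hy
    exact ⟨v + w, fun j ↦ add_mem (hv j) (hw j), by simp [hv', hw']⟩

lemma isTorsion_finsupp (I : Type*) : D.IsTorsion (I →₀ T) :=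
  (D.isTorsion_iSup_range (Finsupp.lsingle (M := T) (R := A))).of_surjective
    (Submodule.subtype _) (fun x ↦ ⟨⟨x, by
      rw [Finsupp.iSup_lsingle_range]; trivial⟩, rfl⟩)

variable {I : Type*}

/-- For `k : I →₀ B`, this is the map `T → (I →₀ T)` given by right multiplication by `k`. -/
noncomputable def tmul (k : I →₀ B) : T →ₗ[A] (I →₀ T) where
  toFun t := k.mapRange (fun b ↦ D.R b t) (by simp [R_zero])
  map_add' _ _ := by ext; simp
  map_smul' _ _ := by ext; simp

@[simp]
lemma tmul_apply (k : I →₀ B) (t : T) (i : I) : D.tmul k t i = D.R (k i) t := rfl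

lemma tmul_zero : D.tmul (0 : I →₀ B) = 0 := by
  ext; simp [R_zero]

lemma tmul_add (k l : I →₀ B) : D.tmul (k + l) = D.tmul k + D.tmul l := by
  ext; simp [R_add]

lemma tmul_smul (b : B) (k : I →₀ B) : D.tmul (b • k) = D.tmul k ∘ₗ D.R b := by
  ext; simp [R_mul]

lemma tmul_surjective (ψ : T →ₗ[A] (I →₀ T)) : ∃ k, D.tmul k = ψ := by
  classical
  choose k hk using fun i ↦ D.R_surjective (Finsupp.lapply i ∘ₗ ψ)
  refine ⟨Finsupp.onFinset ((ψ D.τ₀).support ∪ Finset.univ.biUnion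
    fun j ↦ (ψ (D.τ j)).support) k (fun i hi ↦ ?_), ?_⟩
  · by_contra! h
    simp only [Finset.mem_union, Finset.mem_biUnion, not_or, not_exists, Finset.mem_univ,
      true_and, Finsupp.notMem_support_iff] at h
    exact hi (D.R_injective (by
      rw [hk, R_zero]
      exact D.hom_ext (by simpa using h.1) (fun j ↦ by simpa using h.2 j)))
  · ext t i
    simp [hk]

lemma β_mul_eq {b c : B} (h : D.R b D.τ₀ = D.R c D.τ₀) : D.β D.τ₀ * b = D.β D.τ₀ * c :=
  D.R_injective (by simp [R_mul, comp_homOf, h])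

section

variable (K : Submodule B (I →₀ B))

/-- The tensor product of `T` with the quotient by `K` of the free module. -/
noncomputable abbrev tensorKer : Submodule A (I →₀ T) := ⨆ k : K, LinearMap.range (D.tmul k.1)

lemma exists_e_smul_eq (w : I →₀ T) (hw : w ∈ D.tensorKer K) :
    ∃ k ∈ K, D.e • w = D.tmul k D.τ₀ := by
  induction hw using Submodule.iSup_induction' with
  | mem k x hx =>
    obtain ⟨t, rfl⟩ := hx
    exact ⟨D.β t • k.1, K.smul_mem _ k.2, by simp [tmul_smul]⟩
  | zero => exact ⟨0, zero_mem _, by simp [tmul_zero]⟩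
  | add x y _ _ hx hy =>
    obtain ⟨k, hk, hk'⟩ := hx
    obtain ⟨l, hl, hl'⟩ := hy
    exact ⟨k + l, add_mem hk hl, by simp [tmul_add, hk', hl']⟩

/-- The canonical map from the free module. -/
noncomputable def tensorHom : (I →₀ B) →ₗ[B] D.Hom ((I →₀ T) ⧸ D.tensorKer K) where
  toFun k := (D.tensorKer K).mkQ ∘ₗ D.tmul k
  map_add' k l := by
    rw [tmul_add]
    exact LinearMap.comp_add _ _ _
  map_smul' b k := by
    rw [tmul_smul]
    rfl

lemma tensorHom_surjective : Function.Surjective (D.tensorHom K) := fun φ ↦ by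
  obtain ⟨ψ, hψ⟩ := D.exists_lift (D.tensorKer K).mkQ
    (by rw [Submodule.ker_mkQ]; exact D.isTorsion_iSup_range _) φ
    (fun t ↦ Submodule.mkQ_surjective _ _)
  obtain ⟨k, rfl⟩ := D.tmul_surjective ψ
  exact ⟨k, hψ⟩

lemma ker_tensorHom (π : (I →₀ B) →ₗ[B] N') (hN' : D.IsTorsionFree N') :
    LinearMap.ker (D.tensorHom (LinearMap.ker π)) = LinearMap.ker π := by
  ext k
  have hk : k ∈ LinearMap.ker (D.tensorHom (LinearMap.ker π)) ↔
      ∀ t, D.tmul k t ∈ D.tensorKer (LinearMap.ker π) := by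
    rw [LinearMap.mem_ker]
    trans (D.tensorKer (LinearMap.ker π)).mkQ ∘ₗ D.tmul k = 0
    · rfl
    · simp [LinearMap.ext_iff]
  rw [hk]
  constructor
  · intro h
    refine hN' _ (fun b ↦ ?_)
    obtain ⟨l, hl, hl'⟩ := D.exists_e_smul_eq _ _ (h (D.R b D.τ₀))
    have : D.β D.τ₀ • b • k = D.β D.τ₀ • l := by
      ext i
      refine D.β_mul_eq ?_
      have := DFunLike.congr_fun hl' i
      simpa [← map_smul, R_mul] using this
    rw [← map_smul, ← map_smul, this, map_smul, hl, smul_zero]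
  · intro h t
    exact Submodule.mem_iSup_of_mem ⟨k, h⟩ ⟨t, rfl⟩

end

lemma isTorsion_tensor (K : Submodule B (I →₀ B)) :
    D.IsTorsion ((I →₀ T) ⧸ D.tensorKer K) :=
  (D.isTorsion_finsupp I).of_surjective _ (Submodule.mkQ_surjective _)

/-- A torsion free module identifies to `D.Hom` of its tensor product with `T`. -/
noncomputable def homTensorEquiv (π : (I →₀ B) →ₗ[B] N') (hπ : Function.Surjective π)
    (hN' : D.IsTorsionFree N') :
    D.Hom ((I →₀ T) ⧸ D.tensorKer (LinearMap.ker π)) ≃ₗ[B] N' :=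
  ((D.tensorHom _).quotKerEquivOfSurjective (D.tensorHom_surjective _)).symm ≪≫ₗ
    Submodule.quotEquivOfEq _ _ (D.ker_tensorHom π hN') ≪≫ₗ
    π.quotKerEquivOfSurjective hπ

end

end TiltingPresentation

lemma HomologicalComplex.acyclic_iff_moduleCat_exact {R : Type w₁} [Ring R]
    (K : CochainComplex (ModuleCat.{w₂} R) ℤ) :
    HomologicalComplex.Acyclic K ↔ ∀ (i j k : ℤ), i + 1 = j → j + 1 = k →
      Function.Exact (K.d i j).hom (K.d j k).hom := by
  rw [HomologicalComplex.acyclic_iff]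
  have key (i j k : ℤ) (hij : i + 1 = j) (hjk : j + 1 = k) :
      K.ExactAt j ↔ Function.Exact (K.d i j).hom (K.d j k).hom := by
    rw [K.exactAt_iff' i j k (by simp [← hij]) (by simp [hjk]),
      ShortComplex.moduleCat_exact_iff_range_eq_ker, LinearMap.exact_iff]
    exact eq_comm
  exact ⟨fun h i j k hij hjk ↦ (key i j k hij hjk).1 (h j),
    fun h j ↦ (key (j - 1) j (j + 1) (by simp) rfl).2 (h _ _ _ (by simp) rfl)⟩

namespace TiltingPresentation

variable {A B T : Type w₁} {ι : Type} [Ring A] [Ring B] [AddCommGroup T] [Module A T] [Fintype ι]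
  (D : TiltingPresentation A B T ι)

lemma isTorsion_of_injective (N : Type w₁) [AddCommGroup N] [Module A N] [Module.Injective A N] :
    D.IsTorsion N := by
  classical
  intro x
  let s : A →ₗ[A] (ι → A) := LinearMap.pi fun j ↦ LinearMap.toSpanSingleton A A (D.σ j)
  let q : A →ₗ[A] N := LinearMap.toSpanSingleton A N ((1 - D.e) • x)
  have hsq : LinearMap.ker s ≤ LinearMap.ker q := fun a ha ↦ by
    have := D.mono_σ a (fun j ↦ by simpa [s] using congrFun ha j)
    simp [q, smul_smul, this]
  obtain ⟨p, hp⟩ := Module.Injective.out ((LinearMap.ker s).liftQ s le_rfl)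
    (LinearMap.ker_eq_bot.1 (Submodule.ker_liftQ_eq_bot _ _ _ le_rfl))
    ((LinearMap.ker s).liftQ q hsq)
  refine ⟨fun j ↦ p (Pi.single j 1), ?_⟩
  have h₁ : p D.σ = (1 - D.e) • x := by
    have := hp (Submodule.Quotient.mk 1)
    simp only [Submodule.liftQ_apply] at this
    convert this using 1
    · congr 1
      ext j
      simp [s]
    · simp [q]
  rw [← map_mulσ, ← h₁]
  congr 1
  ext j
  simp [mulσ, Pi.single_apply]

lemma IsTorsion.prod {D : TiltingPresentation A B T ι} {N N' : Type*} [AddCommGroup N]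
    [Module A N] [AddCommGroup N'] [Module A N'] (h : D.IsTorsion N) (h' : D.IsTorsion N') :
    D.IsTorsion (N × N') := fun x ↦ by
  obtain ⟨v, hv⟩ := h x.1
  obtain ⟨w, hw⟩ := h' x.2
  refine ⟨fun j ↦ (v j, w j), Prod.ext ?_ ?_⟩
  · exact (D.map_mulσ (LinearMap.fst A N N') _).trans hv
  · exact (D.map_mulσ (LinearMap.snd A N N') _).trans hw

/-- The property of being torsion, for objects of the category of `A`-modules. -/
def torsion : ObjectProperty (ModuleCat.{w₁} A) := fun N ↦ D.IsTorsion N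

instance : D.torsion.IsClosedUnderIsomorphisms where
  of_iso e h := IsTorsion.of_surjective h e.toLinearEquiv.toLinearMap e.toLinearEquiv.surjective

instance : D.torsion.ContainsZero where
  exists_zero := ⟨ModuleCat.of A PUnit, ModuleCat.isZero_of_subsingleton _,
    fun _ ↦ ⟨0, Subsingleton.elim _ _⟩⟩

instance : D.torsion.IsClosedUnderBinaryProducts where
  limitsOfShape_le := by
    rintro N ⟨p⟩
    have h : D.torsion (ModuleCat.of A (p.diag.obj (.mk .left) × p.diag.obj (.mk .right))) :=
      IsTorsion.prod (p.prop_diag_obj (.mk .left)) (p.prop_diag_obj (.mk .right))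
    refine D.torsion.prop_of_iso ?_ h
    exact IsLimit.conePointUniqueUpToIso (ModuleCat.binaryProductLimitCone _ _).isLimit
      ((IsLimit.postcomposeHomEquiv (diagramIsoPair p.diag) _).2 p.isLimit)

instance : HasBinaryBiproducts D.torsion.FullSubcategory :=
  HasBinaryBiproducts.of_hasBinaryProducts

/-- The functor `Hom(T, -)` from modules over `A` to modules over `B`. -/
def homFunctor : ModuleCat.{w₁} A ⥤ ModuleCat.{w₁} B where
  obj N := ModuleCat.of B (D.Hom N)
  map f := ModuleCat.ofHom
    { toFun φ := LinearMap.comp f.hom (φ : T →ₗ[A] _)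
      map_add' _ _ := LinearMap.comp_add _ _ _
      map_smul' _ _ := rfl }

instance : D.homFunctor.Additive where
  map_add := by
    intros
    ext φ
    exact LinearMap.add_comp _ _ _

/-- The functor `Hom(T, -)` from torsion modules over `A` to modules over `B`. -/
abbrev torsionHomFunctor : D.torsion.FullSubcategory ⥤ ModuleCat.{w₁} B :=
  D.torsion.ι ⋙ D.homFunctor

instance : D.torsionHomFunctor.Faithful where
  map_injective {N N'} f g h := by
    ext : 2
    exact IsTorsion.hom_ext N.property
      (fun φ ↦ DFunLike.congr_fun (congrArg ModuleCat.Hom.hom h) φ)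

instance : D.torsionHomFunctor.Full where
  map_surjective {N N'} Ψ := by
    obtain ⟨f, hf⟩ := IsTorsion.exists_of_hom_map (D := D) N.property Ψ.hom.toAddMonoidHom
      (fun b φ ↦ Ψ.hom.map_smul b φ)
    exact ⟨ObjectProperty.homMk (ModuleCat.ofHom f), by
      ext φ
      exact (hf φ).symm⟩

lemma essImage_torsionHomFunctor_iff (N' : ModuleCat.{w₁} B) :
    D.torsionHomFunctor.essImage N' ↔ D.IsTorsionFree N' := by
  constructor
  · rintro ⟨N, ⟨e⟩⟩
    exact (D.isTorsionFree_hom N.obj).of_injective e.symm.toLinearEquiv.toLinearMap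
      e.symm.toLinearEquiv.injective
  · intro h
    let π : (N' →₀ B) →ₗ[B] N' := Finsupp.linearCombination B id
    exact ⟨⟨ModuleCat.of A _, D.isTorsion_tensor _⟩, ⟨(D.homTensorEquiv π
      (fun x ↦ ⟨Finsupp.single x 1, by simp [π]⟩) h).toModuleIso⟩⟩

lemma acyclic_iff (K : CochainComplex D.torsion.FullSubcategory ℤ) :
    HomologicalComplex.Acyclic ((D.torsion.ι.mapHomologicalComplex (ComplexShape.up ℤ)).obj K) ↔
      HomologicalComplex.Acyclic
        ((D.torsionHomFunctor.mapHomologicalComplex (ComplexShape.up ℤ)).obj K) := by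
  have hd (i j k : ℤ) : (K.d j k).hom.hom ∘ₗ (K.d i j).hom.hom = 0 := by
    have := K.d_comp_d i j k
    rw [← ModuleCat.hom_comp]
    exact congrArg (fun f : K.X i ⟶ K.X k ↦ f.hom.hom) this
  rw [HomologicalComplex.acyclic_iff_moduleCat_exact,
    HomologicalComplex.acyclic_iff_moduleCat_exact]
  constructor
  · intro h i j k hij hjk φ
    refine ⟨fun hφ ↦ ?_, ?_⟩
    · exact D.exact_comp (K.d (i - 1) i).hom.hom (K.d i j).hom.hom (K.d j k).hom.hom
        (K.X (i - 1)).property (h _ _ _ (by simp) hij) (h _ _ _ hij hjk) φ hφ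
    · rintro ⟨ψ, rfl⟩
      exact congrArg (fun f ↦ f ∘ₗ (ψ : T →ₗ[A] _)) (hd i j k)
  · intro h i j k hij hjk
    exact D.exact_of_exact_comp (K.d i j).hom.hom (K.d j k).hom.hom (K.d k (k + 1)).hom.hom
      (K.X j).property (hd _ _ _) (hd _ _ _) (fun φ hφ ↦ (h _ _ _ hij hjk φ).1 hφ)
      (fun φ hφ ↦ (h _ _ _ hjk rfl φ).1 hφ)

end TiltingPresentation

/-- Grothendieck abelian categories have functorial monomorphisms into injective objects. -/
lemma exists_functorial_mono_injective (C : Type w₂) [Category.{w₁} C] [Abelian C]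
    [IsGrothendieckAbelian.{w₁} C] :
    ∃ (Φ : C ⥤ C) (η : 𝟭 C ⟶ Φ), ∀ X, Mono (η.app X) ∧ Injective (Φ.obj X) := by
  open ZeroObject in
  let J : C ⥤ Arrow C :=
    { obj X := Arrow.mk (0 : X ⟶ 0)
      map f := Arrow.homMk f (𝟙 _) }
  let data := MorphismProperty.functorialFactorizationData (MorphismProperty.monomorphisms C)
    (MorphismProperty.monomorphisms C).rlp
  refine ⟨J ⋙ data.Z, { app X := data.i.app (J.obj X)
                        naturality _ _ f := data.i.naturality (J.map f) },
    fun X ↦ ⟨data.hi (J.obj X), ?_⟩⟩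
  rw [injective_iff_rlp_monomorphisms_zero]
  have h := data.hp (J.obj X)
  rw [(isZero_zero C).eq_of_tgt (data.p.app (J.obj X)) 0] at h
  exact h

namespace TiltingPresentation

variable {A B T : Type w₁} {ι : Type} [Ring A] [Ring B] [AddCommGroup T] [Module A T] [Fintype ι]
  (D : TiltingPresentation A B T ι)

lemma essImage_ι_torsion (N : ModuleCat.{w₁} A) : D.torsion.ι.essImage N ↔ D.IsTorsion N :=
  ⟨fun ⟨N', ⟨e⟩⟩ ↦ D.torsion.prop_of_iso e N'.property, fun h ↦ ⟨⟨N, h⟩, ⟨Iso.refl _⟩⟩⟩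

instance isLocalization_ι [HasDerivedCategory (ModuleCat.{w₁} A)] :
    (D.torsion.ι.mapHomologicalComplex (ComplexShape.up ℤ) ⋙ DerivedCategory.Q).IsLocalization
      ((HomologicalComplex.quasiIso _ (ComplexShape.up ℤ)).inverseImage
        (D.torsion.ι.mapHomologicalComplex (ComplexShape.up ℤ))) := by
  obtain ⟨Φ, η, h⟩ := exists_functorial_mono_injective (ModuleCat.{w₁} A)
  refine isLocalization_of_mono _ η (fun X ↦ (h X).1) (fun X ↦ ?_) (fun X Y f _ hX ↦ ?_)
    (fun X Y hX hY ↦ ?_)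
  · rw [essImage_ι_torsion]
    have := (h X).2
    have : Module.Injective A (Φ.obj X) := Module.injective_module_of_injective_object _ _
    exact D.isTorsion_of_injective _
  · rw [essImage_ι_torsion] at hX ⊢
    exact hX.of_surjective f.hom ((ModuleCat.epi_iff_surjective f).1 inferInstance)
  · rw [essImage_ι_torsion] at hX hY ⊢
    exact D.torsion.prop_of_iso (ModuleCat.biprodIsoProd X Y).symm (hX.prod hY)

instance isLocalization_torsionHomFunctor [HasDerivedCategory (ModuleCat.{w₁} B)] :
    (D.torsionHomFunctor.mapHomologicalComplex (ComplexShape.up ℤ) ⋙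
      DerivedCategory.Q).IsLocalization
      ((HomologicalComplex.quasiIso _ (ComplexShape.up ℤ)).inverseImage
        (D.torsionHomFunctor.mapHomologicalComplex (ComplexShape.up ℤ))) := by
  refine isLocalization_of_epi _ (ModuleCat.adj.{w₁} B).counit (fun X ↦ ?_) (fun X ↦ ?_)
    (fun X Y f _ hY ↦ ?_) (fun X Y hX hY ↦ ?_)
  · infer_instance
  · rw [essImage_torsionHomFunctor_iff]
    exact D.isTorsionFree_finsupp X
  · rw [essImage_torsionHomFunctor_iff] at hY ⊢
    exact hY.of_injective f.hom ((ModuleCat.mono_iff_injective f).1 inferInstance)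
  · rw [essImage_torsionHomFunctor_iff] at hX hY ⊢
    exact (hX.prod hY).of_injective (ModuleCat.biprodIsoProd X Y).toLinearEquiv.toLinearMap
      (ModuleCat.biprodIsoProd X Y).toLinearEquiv.injective

theorem exists_derivedCategory_equivalence (D : TiltingPresentation A B T ι)
    [HasDerivedCategory (ModuleCat.{w₁} A)]
    [HasDerivedCategory (ModuleCat.{w₁} B)] :
    ∃ E : DerivedCategory (ModuleCat.{w₁} A) ⥤ DerivedCategory (ModuleCat.{w₁} B),
      E.IsEquivalence ∧ ∃ _ : E.CommShift ℤ, E.IsTriangulated :=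
  CategoryTheory.exists_derivedCategory_equivalence D.torsion.ι D.torsionHomFunctor D.acyclic_iff

end TiltingPresentation

/-- A ring `A` which identifies, with the left-to-right composition, to the ring of endomorphisms
of the source of `f` which extend to an endomorphism of its target. -/
structure SourceEndRing {𝒯 : Type*} [Category* 𝒯] [Preadditive 𝒯] {U N : 𝒯} (f : U ⟶ N)
    (A : Type*) [Ring A] where
  /-- the endomorphism attached to an element of the ring -/
  hom : A →+ (U ⟶ U)
  hom_injective : Function.Injective hom
  hom_one : hom 1 = 𝟙 U
  hom_mul (a b : A) : hom (a * b) = hom a ≫ hom b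
  exists_hom_eq {φ : U ⟶ U} {Φ : N ⟶ N} (h : φ ≫ f = f ≫ Φ) : ∃ a, hom a = φ
  exists_comp_eq (a : A) : ∃ Φ, hom a ≫ f = f ≫ Φ

/-- A ring `B` which identifies, with the left-to-right composition, to the ring of endomorphisms
of the target of `g` which lift to an endomorphism of its source. -/
structure TargetEndRing {𝒯 : Type*} [Category* 𝒯] [Preadditive 𝒯] {N V : 𝒯} (g : N ⟶ V)
    (B : Type*) [Ring B] where
  /-- the endomorphism attached to an element of the ring -/
  hom : B →+ (V ⟶ V)
  hom_injective : Function.Injective hom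
  hom_one : hom 1 = 𝟙 V
  hom_mul (a b : B) : hom (a * b) = hom a ≫ hom b
  exists_hom_eq {ψ : V ⟶ V} {Ψ : N ⟶ N} (h : g ≫ ψ = Ψ ≫ g) : ∃ b, hom b = ψ
  exists_comp_eq (b : B) : ∃ Ψ, g ≫ hom b = Ψ ≫ g

namespace SourceEndRing

variable {𝒯 : Type*} [Category* 𝒯] [Preadditive 𝒯] {U N V : 𝒯} {f : U ⟶ N} {A B : Type*}
  [Ring A] [Ring B] (S : SourceEndRing f A)

attribute [simp] hom_one hom_mul

/-- The element of the ring `A` attached to a morphism from the target of `f` to its source. -/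
noncomputable def ofHom (w : N ⟶ U) : A :=
  (S.exists_hom_eq (φ := f ≫ w) (Φ := w ≫ f) (by simp)).choose

@[simp]
lemma hom_ofHom (w : N ⟶ U) : S.hom (S.ofHom w) = f ≫ w :=
  (S.exists_hom_eq (φ := f ≫ w) (Φ := w ≫ f) (by simp)).choose_spec

/-- The morphisms which are of the form `f ≫ p ≫ g` for some `p`, as a module. -/
@[nolint unusedArguments]
def Bimodule (_ : SourceEndRing f A) (g : N ⟶ V) : Type _ :=
  ((Preadditive.leftComp V f).comp (Preadditive.rightComp N g)).range

variable (g : N ⟶ V)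

instance : AddCommGroup (S.Bimodule g) :=
  inferInstanceAs (AddCommGroup ((Preadditive.leftComp V f).comp (Preadditive.rightComp N g)).range)

/-- The underlying morphism of an element of the bimodule. -/
def val : S.Bimodule g →+ (U ⟶ V) := AddSubgroup.subtype _

variable {g}

lemma val_injective : Function.Injective (S.val g) := Subtype.val_injective

lemma exists_val_eq (t : S.Bimodule g) : ∃ p, S.val g t = f ≫ p ≫ g := by
  obtain ⟨p, hp⟩ := t.2
  exact ⟨p, hp.symm⟩

variable (g) in
/-- The element of the bimodule attached to an endomorphism of the target of `f`. -/
def tensor (p : N ⟶ N) : S.Bimodule g := ⟨f ≫ p ≫ g, p, rfl⟩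

@[simp]
lemma val_tensor (p : N ⟶ N) : S.val g (S.tensor g p) = f ≫ p ≫ g := rfl

instance : SMul A (S.Bimodule g) where
  smul a t := ⟨S.hom a ≫ S.val g t, by
    obtain ⟨p, hp⟩ := S.exists_val_eq t
    obtain ⟨Φ, hΦ⟩ := S.exists_comp_eq a
    refine ⟨Φ ≫ p, ?_⟩
    rw [hp, reassoc_of% hΦ, ← Category.assoc Φ]
    rfl⟩

@[simp]
lemma val_smul (a : A) (t : S.Bimodule g) : S.val g (a • t) = S.hom a ≫ S.val g t := rfl

instance : Module A (S.Bimodule g) where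
  one_smul t := S.val_injective (by simp)
  mul_smul a b t := S.val_injective (by simp)
  smul_zero a := S.val_injective (by simp)
  smul_add a t t' := S.val_injective (by simp)
  add_smul a b t := S.val_injective (by simp)
  zero_smul t := S.val_injective (by simp)

/-- The right action on the bimodule. -/
def rightMul (S' : TargetEndRing g B) (b : B) : S.Bimodule g →ₗ[A] S.Bimodule g where
  toFun t := ⟨S.val g t ≫ S'.hom b, by
    obtain ⟨p, hp⟩ := S.exists_val_eq t
    obtain ⟨Ψ, hΨ⟩ := S'.exists_comp_eq b
    refine ⟨p ≫ Ψ, ?_⟩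
    rw [hp, Category.assoc, Category.assoc, hΨ, ← Category.assoc p]
    rfl⟩
  map_add' t t' := S.val_injective (by
    simp only [map_add]
    exact Preadditive.add_comp _ _ _ _ _ _)
  map_smul' a t := S.val_injective (Category.assoc _ _ _)

@[simp]
lemma val_rightMul (S' : TargetEndRing g B) (b : B) (t : S.Bimodule g) :
    S.val g (S.rightMul S' b t) = S.val g t ≫ S'.hom b := rfl

/-- The right action on the bimodule, as a ring homomorphism. -/
def rightMulHom (S' : TargetEndRing g B) : B →+* (Module.End A (S.Bimodule g))ᵐᵒᵖ where
  toFun b := MulOpposite.op (S.rightMul S' b)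
  map_one' := MulOpposite.unop_injective (LinearMap.ext fun t ↦ S.val_injective (by
    simp [S'.hom_one]))
  map_mul' b c := MulOpposite.unop_injective (LinearMap.ext fun t ↦ S.val_injective (by
    simp [S'.hom_mul]))
  map_zero' := MulOpposite.unop_injective (LinearMap.ext fun t ↦ S.val_injective (by
    simp))
  map_add' b c := MulOpposite.unop_injective (LinearMap.ext fun t ↦ S.val_injective (by
    simp))

end SourceEndRing

lemma sum_comp_comp_of_sum_eq_id {𝒯 ι : Type*} [Category* 𝒯] [Preadditive 𝒯] [Fintype ι]
    {M M₁ : 𝒯} {s : ι → (M₁ ⟶ M)} {r : ι → (M ⟶ M₁)}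
    (hsr : ∑ i, s i ≫ r i = 𝟙 M₁) {Z : 𝒯} (w : M₁ ⟶ Z) :
    ∑ i, s i ≫ r i ≫ w = w := by
  simp only [← Category.assoc, ← Preadditive.sum_comp, hsr, Category.id_comp]

section

variable {𝒯 : Type*} [Category* 𝒯] [Preadditive 𝒯] [HasBinaryBiproducts 𝒯] {M X M₁ Y : 𝒯}
  {f : X ⟶ M₁} {g : M₁ ⟶ Y} {A B ι : Type*} [Ring A] [Ring B]

/-- The morphism `M₁ ⊞ M ⟶ M ⊞ Y` induced by `M₁ ⟶ Y`. -/
noncomputable abbrev biprodDescSwap (M : 𝒯) (g : M₁ ⟶ Y) : M₁ ⊞ M ⟶ M ⊞ Y :=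
  biprod.desc (g ≫ biprod.inr) biprod.inl

namespace SourceEndRing

variable (S : SourceEndRing (biprod.map f (𝟙 M)) A)
  (S' : TargetEndRing (biprodDescSwap M g) B)
  (s : ι → (M₁ ⟶ M)) (r : ι → (M ⟶ M₁))

/-- The first generator of the bimodule. -/
noncomputable def gen₀ : S.Bimodule (biprodDescSwap M g) := S.tensor _ (biprod.snd ≫ biprod.inr)

/-- The other generators of the bimodule. -/
noncomputable def gen (i : ι) : S.Bimodule (biprodDescSwap M g) :=
  S.tensor _ (biprod.snd ≫ r i ≫ biprod.inl)

@[simp]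
lemma val_gen₀ : S.val _ (S.gen₀ (g := g)) = biprod.snd ≫ biprod.inl := by
  simp [gen₀]

@[simp]
lemma val_gen (i : ι) : S.val _ (S.gen (g := g) r i) = biprod.snd ≫ r i ≫ g ≫ biprod.inr := by
  simp [gen]

variable [Fintype ι]

lemma exists_eq_gen (hsr : ∑ i, s i ≫ r i = 𝟙 M₁) (t : S.Bimodule (biprodDescSwap M g)) :
    ∃ (a₀ : A) (a : ι → A), t = a₀ • S.gen₀ + ∑ j, a j • S.gen r j := by
  obtain ⟨p, hp⟩ := S.exists_val_eq t
  refine ⟨S.ofHom (p ≫ biprodDescSwap M g ≫ biprod.fst ≫ biprod.inr),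
    fun j ↦ S.ofHom (p ≫ biprod.fst ≫ s j ≫ biprod.inr), S.val_injective ?_⟩
  have h : ∑ j, s j ≫ r j ≫ g ≫ (biprod.inr : Y ⟶ M ⊞ Y) = g ≫ biprod.inr :=
    sum_comp_comp_of_sum_eq_id hsr _
  simp only [map_add, map_sum, val_smul, hom_ofHom, val_gen₀, val_gen, hp, Category.assoc,
    biprod.inr_snd_assoc, ← Preadditive.comp_sum, h, ← Preadditive.comp_add]
  congr 2
  ext <;> simp


lemma smul_gen₀ : S.ofHom (biprod.snd ≫ biprod.inr) • S.gen₀ (g := g) = S.gen₀ :=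
  S.val_injective (by simp)

lemma sum_smul_gen (hsr : ∑ i, s i ≫ r i = 𝟙 M₁) (i : ι) :
    ∑ j, S.ofHom (biprod.snd ≫ r i ≫ s j ≫ biprod.inr) • S.gen (g := g) r j = S.gen r i :=
  S.val_injective (by
    simp [← Preadditive.comp_sum, sum_comp_comp_of_sum_eq_id hsr])

lemma sum_smul_gen_eq_zero (hsr : ∑ i, s i ≫ r i = 𝟙 M₁) (hfg : f ≫ g = 0) :
    ∑ j, S.ofHom (biprod.fst ≫ s j ≫ biprod.inr) • S.gen (g := g) r j = 0 :=
  S.val_injective (by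
    simp [← Preadditive.comp_sum, sum_comp_comp_of_sum_eq_id hsr, reassoc_of% hfg])

lemma rightMulHom_injective (hsr : ∑ i, s i ≫ r i = 𝟙 M₁)
    (hgM : ∀ w : Y ⟶ M, g ≫ w = 0 → w = 0) (hgY : ∀ w : Y ⟶ Y, g ≫ w = 0 → w = 0) :
    Function.Injective (S.rightMulHom S') := by
  rw [injective_iff_map_eq_zero]
  intro b hb
  have hb' (t : S.Bimodule (biprodDescSwap M g)) : S.val _ t ≫ S'.hom b = 0 := by
    have := congr_arg (fun φ : (Module.End A (S.Bimodule (biprodDescSwap M g)))ᵐᵒᵖ ↦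
      S.val _ (φ.unop t)) hb
    simpa [rightMulHom] using this
  have h₀ : biprod.inl ≫ S'.hom b = 0 := by
    simpa using biprod.inr ≫= hb' S.gen₀
  have h₁ : g ≫ biprod.inr ≫ S'.hom b = 0 := by
    rw [← sum_comp_comp_of_sum_eq_id hsr (g ≫ biprod.inr ≫ S'.hom b)]
    refine Finset.sum_eq_zero fun i _ ↦ ?_
    have : r i ≫ g ≫ biprod.inr ≫ S'.hom b = 0 := by
      simpa using biprod.inr ≫= hb' (S.gen r i)
    rw [this, comp_zero]
  have h₂ : biprod.inr ≫ S'.hom b = 0 := by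
    ext
    · simpa using hgM (biprod.inr ≫ S'.hom b ≫ biprod.fst) (by simp [reassoc_of% h₁])
    · simpa using hgY (biprod.inr ≫ S'.hom b ≫ biprod.snd) (by simp [reassoc_of% h₁])
  exact (injective_iff_map_eq_zero _).1 S'.hom_injective _
    (by ext <;> simp [reassoc_of% h₀, reassoc_of% h₂])

lemma rightMulHom_surjective (hsr : ∑ i, s i ≫ r i = 𝟙 M₁) (hfg : f ≫ g = 0)
    (hg' : ∀ w : M₁ ⟶ M ⊞ Y, f ≫ w = 0 → ∃ v, w = g ≫ v) :
    Function.Surjective (S.rightMulHom S') := by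
  intro φ
  obtain ⟨φ, rfl⟩ := MulOpposite.op_surjective φ
  obtain ⟨p₀, hp₀⟩ := S.exists_val_eq (φ S.gen₀)
  choose p hp using fun i ↦ S.exists_val_eq (φ (S.gen r i))
  let b₀ : M ⟶ M ⊞ Y := biprod.inr ≫ S.val _ (φ S.gen₀)
  let K : M₁ ⟶ M ⊞ Y := ∑ i, s i ≫ biprod.inr ≫ S.val _ (φ (S.gen r i))
  have hK : f ≫ K = 0 := by
    have := congr_arg (fun t ↦ biprod.inl ≫ S.val _ (φ t)) (S.sum_smul_gen_eq_zero s r hsr hfg)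
    simpa [K, Preadditive.comp_sum] using this
  obtain ⟨K', hK'⟩ := hg' K hK
  obtain ⟨b, hb⟩ := S'.exists_hom_eq (ψ := biprod.desc b₀ K')
    (Ψ := biprod.desc (∑ i, s i ≫ biprod.inr ≫ p i) (biprod.inr ≫ p₀)) (by
      ext1
      · simp [← hK', K, hp, Preadditive.sum_comp]
      · simp [b₀, hp₀])
  refine ⟨b, MulOpposite.unop_injective (LinearMap.ext fun t ↦ ?_)⟩
  have h₀ : S.rightMul S' b S.gen₀ = φ S.gen₀ := S.val_injective (by
    conv_rhs => rw [← smul_gen₀, map_smul]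
    simp [hb, b₀])
  have h₁ (i) : S.rightMul S' b (S.gen r i) = φ (S.gen r i) := S.val_injective (by
    conv_rhs => rw [← S.sum_smul_gen s r hsr, map_sum]
    simp [hb, ← hK', K, Preadditive.comp_sum])
  obtain ⟨a₀, a, rfl⟩ := S.exists_eq_gen s r hsr t
  change S.rightMul S' b _ = φ _
  simp [h₀, h₁]

/-- The tilting bimodule attached to an exact sequence `X ⟶ M₁ ⟶ Y`. -/
noncomputable def tiltingPresentation (hsr : ∑ i, s i ≫ r i = 𝟙 M₁) (hfg : f ≫ g = 0)
    (hfX : ∀ u : X ⟶ X, u ≫ f = 0 → u = 0) (hfM : ∀ u : M ⟶ X, u ≫ f = 0 → u = 0)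
    (hgM : ∀ w : Y ⟶ M, g ≫ w = 0 → w = 0) (hgY : ∀ w : Y ⟶ Y, g ≫ w = 0 → w = 0)
    (hf' : ∀ u : X ⊞ M ⟶ M₁, u ≫ g = 0 → ∃ v, u = v ≫ f)
    (hg' : ∀ w : M₁ ⟶ M ⊞ Y, f ≫ w = 0 → ∃ v, w = g ≫ v) :
    TiltingPresentation A B (S.Bimodule (biprodDescSwap M g)) ι where
  act := RingEquiv.ofBijective (S.rightMulHom S')
    ⟨S.rightMulHom_injective S' s r hsr hgM hgY, S.rightMulHom_surjective S' s r hsr hfg hg'⟩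
  e := S.ofHom (biprod.snd ≫ biprod.inr)
  ρ i j := S.ofHom (biprod.snd ≫ r i ≫ s j ≫ biprod.inr)
  σ j := S.ofHom (biprod.fst ≫ s j ≫ biprod.inr)
  τ₀ := S.gen₀
  τ := S.gen r
  e_mul_e := S.hom_injective (by simp)
  e_mul_ρ i j := S.hom_injective (by simp)
  ρ_mul_e i j := S.hom_injective (by simp)
  ρ_mul_ρ i k := S.hom_injective (by
    simp [← Preadditive.comp_sum, sum_comp_comp_of_sum_eq_id hsr])
  σ_mul_ρ k := S.hom_injective (by
    simp [← Preadditive.comp_sum, sum_comp_comp_of_sum_eq_id hsr])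
  e_mul_σ j := S.hom_injective (by simp)
  e_smul_τ₀ := S.smul_gen₀
  ρ_smul_τ := S.sum_smul_gen s r hsr
  σ_smul_τ := S.sum_smul_gen_eq_zero s r hsr hfg
  exists_eq := S.exists_eq_gen s r hsr
  rel a₀ a h := by
    replace h := congr_arg (S.val _) h
    simp only [map_add, map_sum, val_smul, val_gen₀, val_gen, map_zero] at h
    have h₀ := h =≫ biprod.fst
    have h₁ := h =≫ biprod.snd
    simp only [Preadditive.add_comp, Preadditive.sum_comp, Category.assoc, biprod.inl_fst,
      biprod.inr_fst, biprod.inl_snd, biprod.inr_snd, comp_zero, Category.comp_id,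
      Finset.sum_const_zero, add_zero, zero_add, zero_comp] at h₀ h₁
    refine ⟨S.hom_injective (by simp [reassoc_of% h₀]), ?_⟩
    choose Φ hΦ using fun j ↦ S.exists_comp_eq (a j)
    obtain ⟨u, hu⟩ := hf' (∑ j, S.hom (a j) ≫ biprod.snd ≫ r j)
      (by simpa [Preadditive.sum_comp] using h₁)
    have hΦ' (j) : S.hom (a j) ≫ biprod.snd = biprod.map f (𝟙 M) ≫ Φ j ≫ biprod.snd := by
      simp [← reassoc_of% (hΦ j)]
    obtain ⟨c, hc⟩ := S.exists_hom_eq (φ := u ≫ biprod.inl)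
      (Φ := ∑ j, Φ j ≫ biprod.snd ≫ r j ≫ biprod.inl) (by
        simp only [Category.assoc, biprod.inl_map, ← reassoc_of% hu, Preadditive.sum_comp,
          Preadditive.comp_sum]
        simp only [reassoc_of% hΦ'])
    refine ⟨c, fun k ↦ S.hom_injective ?_⟩
    simp [hc, ← reassoc_of% hu, Preadditive.sum_comp]
  exists_decomp a := by
    obtain ⟨Φ, hΦ⟩ := S.exists_comp_eq a
    refine ⟨fun j ↦ S.ofHom (biprod.snd ≫ r j ≫ biprod.inl ≫ Φ ≫ biprod.snd ≫ biprod.inr),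
      S.hom_injective ?_⟩
    have h : 𝟙 (X ⊞ M) - biprod.snd ≫ biprod.inr = biprod.fst ≫ biprod.inl := by
      rw [← biprod.total, add_sub_cancel_right]
    have hΦ' : S.hom a ≫ biprod.snd = biprod.map f (𝟙 M) ≫ Φ ≫ biprod.snd := by
      simp [← reassoc_of% hΦ]
    simp [h, ← Preadditive.comp_sum, sum_comp_comp_of_sum_eq_id hsr, reassoc_of% hΦ']
  mono_σ a h := by
    have h' : 𝟙 (X ⊞ M) - biprod.snd ≫ biprod.inr = biprod.fst ≫ biprod.inl := by
      rw [← biprod.total, add_sub_cancel_right]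
    have h₁ : S.hom a ≫ biprod.fst ≫ f = 0 := by
      have h₂ : S.hom a ≫ biprod.fst ≫ f = ∑ j, S.hom a ≫ biprod.fst ≫ f ≫ s j ≫ r j := by
        simp only [← Preadditive.comp_sum, hsr, Category.comp_id]
      rw [h₂]
      refine Finset.sum_eq_zero fun j _ ↦ ?_
      have := congr_arg S.hom (h j) =≫ biprod.snd
      simp only [hom_mul, hom_ofHom, biprod.map_fst_assoc, Category.assoc, biprod.inr_snd,
        Category.comp_id, map_zero, zero_comp] at this
      rw [reassoc_of% this, zero_comp]
    have h₂ : S.hom a ≫ biprod.fst = 0 := by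
      ext
      · simpa using hfX (biprod.inl ≫ S.hom a ≫ biprod.fst) (by simp [h₁])
      · simpa using hfM (biprod.inr ≫ S.hom a ≫ biprod.fst) (by simp [h₁])
    exact S.hom_injective (by simp [h', reassoc_of% h₂])

end SourceEndRing

end

/-- A subring of `(End (X ⊞ M))ᵐᵒᵖ` given by conditions on the components identifies to the ring
of endomorphisms of `X ⊞ M` which extend along `X ⊞ M ⟶ M₁ ⊞ M`. -/
def sourceEndRingOfSubring {𝒯 : Type*} [Category* 𝒯] [Preadditive 𝒯] [HasBinaryBiproducts 𝒯]
    {X M M₁ : 𝒯} {f : X ⟶ M₁} (A : Subring ((End (X ⊞ M))ᵐᵒᵖ))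
    (hA : ∀ φ : End (X ⊞ M), MulOpposite.op φ ∈ A ↔
      ((∃ t' : M₁ ⟶ M₁, (biprod.inl ≫ φ ≫ biprod.fst) ≫ f = f ≫ t') ∧
        (∃ s : M₁ ⟶ M, biprod.inl ≫ φ ≫ biprod.snd = f ≫ s))) :
    SourceEndRing (biprod.map f (𝟙 M)) A where
  hom :=
    { toFun a := MulOpposite.unop a.1
      map_zero' := rfl
      map_add' _ _ := rfl }
  hom_injective _ _ h := Subtype.ext (MulOpposite.unop_injective h)
  hom_one := rfl
  hom_mul _ _ := rfl
  exists_hom_eq {φ Φ} h := by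
    refine ⟨⟨MulOpposite.op φ, (hA φ).2 ⟨⟨biprod.inl ≫ Φ ≫ biprod.fst, ?_⟩,
      ⟨biprod.inl ≫ Φ ≫ biprod.snd, ?_⟩⟩⟩, rfl⟩
    · simpa using biprod.inl ≫= h =≫ biprod.fst
    · simpa using biprod.inl ≫= h =≫ biprod.snd
  exists_comp_eq a := by
    obtain ⟨⟨t', ht'⟩, s, hs⟩ := (hA (MulOpposite.unop a.1)).1 a.2
    refine ⟨biprod.desc (biprod.lift t' s)
      (biprod.inr ≫ MulOpposite.unop a.1 ≫ biprod.map f (𝟙 M)), ?_⟩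
    simp only [Category.assoc] at ht' hs
    ext
    · simpa using ht'
    · simpa using hs
    · simp
    · simp

/-- A subring of `(End (M ⊞ Y))ᵐᵒᵖ` given by conditions on the components identifies to the ring
of endomorphisms of `M ⊞ Y` which lift along `M₁ ⊞ M ⟶ M ⊞ Y`. -/
def targetEndRingOfSubring {𝒯 : Type*} [Category* 𝒯] [Preadditive 𝒯] [HasBinaryBiproducts 𝒯]
    {M M₁ Y : 𝒯} {g : M₁ ⟶ Y} (B : Subring ((End (M ⊞ Y))ᵐᵒᵖ))
    (hB : ∀ ψ : End (M ⊞ Y), MulOpposite.op ψ ∈ B ↔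
      ((∃ t' : M₁ ⟶ M₁, g ≫ (biprod.inr ≫ ψ ≫ biprod.snd) = t' ≫ g) ∧
        (∃ s : M ⟶ M₁, biprod.inl ≫ ψ ≫ biprod.snd = s ≫ g))) :
    TargetEndRing (biprodDescSwap M g) B where
  hom :=
    { toFun b := MulOpposite.unop b.1
      map_zero' := rfl
      map_add' _ _ := rfl }
  hom_injective _ _ h := Subtype.ext (MulOpposite.unop_injective h)
  hom_one := rfl
  hom_mul _ _ := rfl
  exists_hom_eq {ψ Ψ} h := by
    have hg : biprodDescSwap M g ≫ biprod.snd = biprod.fst ≫ g := by ext <;> simp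
    refine ⟨⟨MulOpposite.op ψ, (hB ψ).2 ⟨⟨biprod.inl ≫ Ψ ≫ biprod.fst, ?_⟩,
      ⟨biprod.inr ≫ Ψ ≫ biprod.fst, ?_⟩⟩⟩, rfl⟩
    · simpa [hg] using biprod.inl ≫= h =≫ biprod.snd
    · simpa [hg] using biprod.inr ≫= h =≫ biprod.snd
  exists_comp_eq b := by
    obtain ⟨⟨t', ht'⟩, s, hs⟩ := (hB (MulOpposite.unop b.1)).1 b.2
    refine ⟨biprod.desc (biprod.lift t' (g ≫ biprod.inr ≫ MulOpposite.unop b.1 ≫ biprod.fst))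
      (biprod.lift s (biprod.inl ≫ MulOpposite.unop b.1 ≫ biprod.fst)), ?_⟩
    ext
    · simp
    · simpa using ht'
    · simp
    · simpa using hs

section

variable {𝒯 : Type*} [Category* 𝒯] [Preadditive 𝒯] [HasZeroObject 𝒯] [HasShift 𝒯 ℤ]
  [∀ n : ℤ, (shiftFunctor 𝒯 n).Additive] [Pretriangulated 𝒯]

lemma CategoryTheory.Pretriangulated.eq_zero_of_comp_mor₁_eq_zero (T : Triangle 𝒯)
    (hT : T ∈ distTriang 𝒯) {Z : 𝒯} (hZ : ∀ φ : Z⟦(1 : ℤ)⟧ ⟶ T.obj₃, φ = 0) (u : Z ⟶ T.obj₁)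
    (hu : u ≫ T.mor₁ = 0) : u = 0 := by
  obtain ⟨w, hw⟩ := Triangle.coyoneda_exact₁ _ hT (u⟦(1 : ℤ)⟧')
    (by rw [← Functor.map_comp, hu, Functor.map_zero])
  refine (shiftFunctor 𝒯 (1 : ℤ)).map_injective ?_
  rw [hw, hZ w, zero_comp, Functor.map_zero]

lemma CategoryTheory.Pretriangulated.eq_zero_of_mor₂_comp_eq_zero (T : Triangle 𝒯)
    (hT : T ∈ distTriang 𝒯) {Z : 𝒯} (hZ : ∀ φ : T.obj₁⟦(1 : ℤ)⟧ ⟶ Z, φ = 0) (w : T.obj₃ ⟶ Z)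
    (hw : T.mor₂ ≫ w = 0) : w = 0 := by
  obtain ⟨u, hu⟩ := Triangle.yoneda_exact₃ _ hT w hw
  rw [hu, hZ u, comp_zero]

end

/-- Theorem 1.1 of the paper for `n = 3`, `Φ = {0}`.
Let `T` be a pretriangulated category with (finite) biproducts, `M` an object
of `T` and `X ⟶f M₁ ⟶g Y ⟶h X⟦1⟧` a distinguished triangle with `M₁ ∈ add M`,
and assume `Hom(X⟦1⟧, Y) = 0`, `Hom(X⟦1⟧, M) = 0` and `Hom(M⟦1⟧, Y) = 0`.
The rings `A` and `B` (with multiplication given by left-to-right composition,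
i.e. the subrings of `(End (X ⊞ M))ᵐᵒᵖ` resp. `(End (M ⊞ Y))ᵐᵒᵖ` with the
indicated carriers) are derived equivalent. -/
theorem statement9 {T : Type u} [Category.{v} T] [Preadditive T] [HasZeroObject T]
    [HasShift T ℤ] [∀ n : ℤ, (shiftFunctor T n).Additive] [Pretriangulated T]
    [HasBinaryBiproducts T] [HasFiniteBiproducts T]
    (M X M₁ Y : T) (f : X ⟶ M₁) (g : M₁ ⟶ Y) (h : Y ⟶ X⟦(1 : ℤ)⟧)
    (hT : Triangle.mk f g h ∈ distTriang T)
    (hadd : ∃ (n : ℕ) (s : M₁ ⟶ ⨁ fun _ : Fin n => M) (r : (⨁ fun _ : Fin n => M) ⟶ M₁),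
      s ≫ r = 𝟙 M₁)
    (hXY : ∀ φ : (X⟦(1 : ℤ)⟧ : T) ⟶ Y, φ = 0)
    (hXM : ∀ φ : (X⟦(1 : ℤ)⟧ : T) ⟶ M, φ = 0)
    (hMY : ∀ φ : (M⟦(1 : ℤ)⟧ : T) ⟶ Y, φ = 0)
    (A : Subring ((End (X ⊞ M))ᵐᵒᵖ))
    (hA : ∀ φ : End (X ⊞ M), MulOpposite.op φ ∈ A ↔
      ((∃ t' : M₁ ⟶ M₁, (biprod.inl ≫ φ ≫ biprod.fst) ≫ f = f ≫ t') ∧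
        (∃ s : M₁ ⟶ M, biprod.inl ≫ φ ≫ biprod.snd = f ≫ s)))
    (B : Subring ((End (M ⊞ Y))ᵐᵒᵖ))
    (hB : ∀ ψ : End (M ⊞ Y), MulOpposite.op ψ ∈ B ↔
      ((∃ t' : M₁ ⟶ M₁, g ≫ (biprod.inr ≫ ψ ≫ biprod.snd) = t' ≫ g) ∧
        (∃ s : M ⟶ M₁, biprod.inl ≫ ψ ≫ biprod.snd = s ≫ g))) :
    RingsDerivedEquivalent A B := by
  let : HasDerivedCategory (ModuleCat.{v} A) := HasDerivedCategory.standard _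
  let : HasDerivedCategory (ModuleCat.{v} B) := HasDerivedCategory.standard _
  obtain ⟨n, s, r, hsr⟩ := hadd
  have hsr' : ∑ i, (s ≫ biproduct.π _ i) ≫ (biproduct.ι (fun _ : Fin n ↦ M) i ≫ r) = 𝟙 M₁ := by
    have := s ≫= biproduct.total (f := fun _ : Fin n ↦ M) =≫ r
    rw [Category.id_comp, hsr] at this
    simpa only [Preadditive.comp_sum, Preadditive.sum_comp, Category.assoc] using this
  exact ((sourceEndRingOfSubring A hA).tiltingPresentation (targetEndRingOfSubring B hB) _ _ hsr'
    (comp_distTriang_mor_zero₁₂ _ hT)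
    (eq_zero_of_comp_mor₁_eq_zero _ hT hXY)
    (eq_zero_of_comp_mor₁_eq_zero _ hT hMY)
    (eq_zero_of_mor₂_comp_eq_zero _ hT hXM)
    (eq_zero_of_mor₂_comp_eq_zero _ hT hXY)
    (fun u hu ↦ Triangle.coyoneda_exact₂ _ hT u hu)
    (fun w hw ↦ Triangle.yoneda_exact₂ _ hT w hw)).exists_derivedCategory_equivalence
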